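/- arXiv:2405.19717 — 3 statements merged into one kernel-verified Lean document; each statement's English description precedes it below -/
import Mathlib

section
/- For n ≥ 4, crx_2(W_n) = ⌈n/2⌉ + 2, where W_n is the wheel on n+1 vertices; moreover crx_2(W_3) = 3. -/
open SimpleGraph

/-- `G.CycleThrough S`: there is a cycle in `G` containing all vertices of `S`. -/
def SimpleGraph.CycleThrough {V : Type*} (G : SimpleGraph V) (S : Set V) : Prop :=
  ∃ (u : V) (c : G.Walk u u), c.IsCycle ∧ ∀ v ∈ S, v ∈ c.support

/-- A `k`-rainbow cycle colouring: every `k`-set of vertices lies in a cycle whose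
edges receive pairwise distinct colours. -/
def SimpleGraph.IsRainbowCycleColoring {V : Type*} (G : SimpleGraph V) (k : ℕ)
    (φ : Sym2 V → ℕ) : Prop :=
  ∀ S : Finset V, S.card = k →
    ∃ (u : V) (c : G.Walk u u), c.IsCycle ∧ (∀ v ∈ S, v ∈ c.support) ∧
      (c.edges.map φ).Nodup

/-- The `k`-rainbow cycle index `crx_k(G)`. -/
noncomputable def SimpleGraph.crx {V : Type*} (G : SimpleGraph V) (k : ℕ) : ℕ :=
  sInf {r | ∃ φ : Sym2 V → ℕ, (∀ e ∈ G.edgeSet, φ e < r) ∧ G.IsRainbowCycleColoring k φ}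

/-- Number of edges of `G`. -/
noncomputable def SimpleGraph.numEdges {V : Type*} (G : SimpleGraph V) : ℕ :=
  Nat.card G.edgeSet

/-- A graph is 2-connected if it has more than 2 vertices and deleting any vertex
leaves it connected. -/
def SimpleGraph.IsTwoConnected {V : Type*} (G : SimpleGraph V) : Prop :=
  2 < Nat.card V ∧ ∀ v : V, (G.induce {w | w ≠ v}).Connected

/-- A graph is Hamiltonian if it has a cycle through all its vertices. -/
def SimpleGraph.IsHamiltonianGraph {V : Type*} (G : SimpleGraph V) : Prop :=
  ∃ (u : V) (c : G.Walk u u), c.IsCycle ∧ ∀ v : V, v ∈ c.support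

/-- The wheel `W_n`: a centre vertex `none` joined to every vertex of the cycle `C_n`. -/
def wheelGraph (n : ℕ) : SimpleGraph (Option (Fin n)) :=
  SimpleGraph.fromRel (fun u v =>
    u = none ∨ ∃ a b : Fin n, u = some a ∧ v = some b ∧ (SimpleGraph.cycleGraph n).Adj a b)

namespace Wheel

lemma eq_of_modEq_of_lt {n s t : ℕ} (h : s ≡ t [MOD n]) (hst : s ≤ t) (ht : t < s + n) : s = t := by
  have h1 := (Nat.modEq_iff_dvd' hst).1 h
  have h2 := Nat.eq_zero_of_dvd_of_lt h1 (by omega)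
  omega

variable {n : ℕ} [NeZero n]

/-- The rim vertex with index `t` modulo `n`. -/
def rim (n : ℕ) [NeZero n] (t : ℕ) : Option (Fin n) := some (Fin.ofNat n t)

/-- The rim edge from `rim n t` to `rim n (t + 1)`. -/
def rimEdge (n : ℕ) [NeZero n] (t : ℕ) : Sym2 (Option (Fin n)) := s(rim n t, rim n (t + 1))

/-- The spoke at `rim n t`. -/
def spoke (n : ℕ) [NeZero n] (t : ℕ) : Sym2 (Option (Fin n)) := s(none, rim n t)

lemma rim_ne_none (t : ℕ) : rim n t ≠ none := Option.some_ne_none _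

lemma none_ne_rim (t : ℕ) : none ≠ rim n t := (rim_ne_none t).symm

lemma rim_eq_iff {s t : ℕ} : rim n s = rim n t ↔ s ≡ t [MOD n] := by
  simp [rim, Fin.ext_iff, Nat.ModEq]

lemma rim_val (i : Fin n) : rim n i.val = some i := by
  simp [rim]

lemma spoke_eq_iff {s t : ℕ} : spoke n s = spoke n t ↔ s ≡ t [MOD n] := by
  rw [← rim_eq_iff]
  simp [spoke, none_ne_rim]

lemma rimEdge_ne_spoke (s t : ℕ) : rimEdge n s ≠ spoke n t := by
  simp [rimEdge, spoke, rim_ne_none]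

lemma rimEdge_eq_iff (hn : 3 ≤ n) {s t : ℕ} :
    rimEdge n s = rimEdge n t ↔ s ≡ t [MOD n] := by
  simp only [rimEdge, Sym2.eq_iff, rim_eq_iff]
  refine ⟨?_, fun h => Or.inl ⟨h, h.add_right 1⟩⟩
  rintro (⟨h, -⟩ | ⟨h1, h2⟩)
  · exact h
  · have h3 : t ≡ t + 2 [MOD n] := h2.symm.trans (h1.add_right 1)
    have := eq_of_modEq_of_lt h3 (by omega) (by omega)
    omega

lemma rim_periodic (t : ℕ) : rim n (t + n) = rim n t := by
  simp [rim_eq_iff, Nat.ModEq]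

lemma rimEdge_periodic (t : ℕ) : rimEdge n (t + n) = rimEdge n t := by
  rw [rimEdge, rimEdge, rim_periodic, show t + n + 1 = t + 1 + n by ring, rim_periodic]

lemma spoke_periodic (t : ℕ) : spoke n (t + n) = spoke n t := by
  rw [spoke, spoke, rim_periodic]

lemma adj_none_rim (t : ℕ) : (wheelGraph n).Adj none (rim n t) := by
  simp [wheelGraph, rim]

lemma eq_none_or_eq_rim (w : Option (Fin n)) : w = none ∨ ∃ t < n, w = rim n t := by
  cases w with
  | none => exact Or.inl rfl
  | some b => exact Or.inr ⟨b, b.isLt, (rim_val b).symm⟩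

lemma adj_rim_rim (hn : 2 ≤ n) {s t : ℕ} :
    (wheelGraph n).Adj (rim n s) (rim n t) ↔ t ≡ s + 1 [MOD n] ∨ s ≡ t + 1 [MOD n] := by
  have key : ∀ s t : ℕ, Fin.ofNat n s = Fin.ofNat n t + 1 ↔ s ≡ t + 1 [MOD n] := by
    intro s t
    simp [Fin.ext_iff, Nat.ModEq, Fin.val_add]
  obtain ⟨m, rfl⟩ := Nat.exists_eq_add_of_le' hn
  rw [← key, ← key, wheelGraph, SimpleGraph.fromRel_adj]
  simp only [rim]
  generalize Fin.ofNat (m + 2) s = a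
  generalize Fin.ofNat (m + 2) t = b
  have hab : a = b → ¬ a = b + 1 ∧ ¬ b = a + 1 := by
    rintro rfl
    simp
  simp only [reduceCtorEq, false_or, Option.some.injEq, exists_eq_left', cycleGraph_adj,
    exists_and_left, ne_eq, sub_eq_iff_eq_add']
  tauto

lemma adj_rim_succ (hn : 2 ≤ n) (t : ℕ) : (wheelGraph n).Adj (rim n t) (rim n (t + 1)) :=
  (adj_rim_rim hn).2 (Or.inl rfl)

lemma adj_rim_iff (hn : 2 ≤ n) {t : ℕ} {w : Option (Fin n)} :
    (wheelGraph n).Adj (rim n (t + 1)) w ↔ w = none ∨ w = rim n t ∨ w = rim n (t + 2) := by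
  obtain rfl | ⟨b, -, rfl⟩ := eq_none_or_eq_rim w
  · simpa using (adj_none_rim (t + 1)).symm
  · rw [adj_rim_rim hn, rim_eq_iff, rim_eq_iff]
    simp only [rim_ne_none, false_or]
    have : t + 1 ≡ b + 1 [MOD n] ↔ b ≡ t [MOD n] :=
      ⟨fun h => (Nat.ModEq.add_right_cancel' 1 h).symm, fun h => h.symm.add_right 1⟩
    rw [this, or_comm]

section Cycle

variable {u : Option (Fin n)} {c : (wheelGraph n).Walk u u}

lemma rim_mem_support_of_rimEdge_mem {t : ℕ} (h : rimEdge n t ∈ c.edges) :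
    rim n t ∈ c.support ∧ rim n (t + 1) ∈ c.support :=
  ⟨c.fst_mem_support_of_mem_edges h, c.snd_mem_support_of_mem_edges h⟩

lemma edges_at_rim (hn : 3 ≤ n) (hc : c.IsCycle) {t : ℕ} (ht : rim n (t + 1) ∈ c.support) :
    (rimEdge n t ∈ c.edges ∧ rimEdge n (t + 1) ∈ c.edges ∧ spoke n (t + 1) ∉ c.edges) ∨
    (rimEdge n t ∈ c.edges ∧ rimEdge n (t + 1) ∉ c.edges ∧ spoke n (t + 1) ∈ c.edges) ∨
    (rimEdge n t ∉ c.edges ∧ rimEdge n (t + 1) ∈ c.edges ∧ spoke n (t + 1) ∈ c.edges) := by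
  have h2 := hc.ncard_neighborSet_toSubgraph_eq_two ht
  obtain ⟨a, b, hab, hN⟩ := Set.ncard_eq_two.1 h2
  have hmem : ∀ w, s(rim n (t + 1), w) ∈ c.edges ↔ w = a ∨ w = b := by
    intro w
    have : w ∈ c.toSubgraph.neighborSet (rim n (t + 1)) ↔ w = a ∨ w = b := by simp [hN]
    rwa [Subgraph.mem_neighborSet, Walk.adj_toSubgraph_iff_mem_edges] at this
  have hadj : ∀ w, s(rim n (t + 1), w) ∈ c.edges → w = none ∨ w = rim n t ∨ w = rim n (t + 2) :=
    fun w hw => (adj_rim_iff (by omega)).1 (c.adj_of_mem_edges hw)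
  have hne : rim n t ≠ rim n (t + 2) := fun h => by
    have := eq_of_modEq_of_lt (rim_eq_iff.1 h) (by omega) (by omega)
    omega
  have e1 : rimEdge n t ∈ c.edges ↔ rim n t = a ∨ rim n t = b := by
    rw [← hmem, rimEdge, Sym2.eq_swap]
  have e2 : rimEdge n (t + 1) ∈ c.edges ↔ rim n (t + 2) = a ∨ rim n (t + 2) = b := by
    rw [← hmem, rimEdge]
  have e3 : spoke n (t + 1) ∈ c.edges ↔ none = a ∨ none = b := by
    rw [← hmem, spoke, Sym2.eq_swap]
  have ha := hadj a ((hmem a).2 (Or.inl rfl))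
  have hb := hadj b ((hmem b).2 (Or.inr rfl))
  rw [e1, e2, e3]
  have h3 := none_ne_rim (n := n) t
  have h4 := none_ne_rim (n := n) (t + 2)
  clear e1 e2 e3 hmem hN h2 hadj
  grind

lemma exists_spokes (hc : c.IsCycle) {t : ℕ} (ht : spoke n t ∈ c.edges) :
    ∃ i j : ℕ, ¬ i ≡ j [MOD n] ∧
      ∀ s, spoke n s ∈ c.edges ↔ s ≡ i [MOD n] ∨ s ≡ j [MOD n] := by
  have h2 := hc.ncard_neighborSet_toSubgraph_eq_two (c.fst_mem_support_of_mem_edges ht)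
  obtain ⟨a, b, hab, hN⟩ := Set.ncard_eq_two.1 h2
  have hmem : ∀ w, s(none, w) ∈ c.edges ↔ w = a ∨ w = b := by
    intro w
    have : w ∈ c.toSubgraph.neighborSet none ↔ w = a ∨ w = b := by simp [hN]
    rwa [Subgraph.mem_neighborSet, Walk.adj_toSubgraph_iff_mem_edges] at this
  have hrim : ∀ w, s(none, w) ∈ c.edges → ∃ i, w = rim n i := by
    intro w hw
    obtain rfl | ⟨i, -, hi⟩ := eq_none_or_eq_rim w
    · exact absurd rfl (c.adj_of_mem_edges hw).ne
    · exact ⟨i, hi⟩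
  obtain ⟨i, rfl⟩ := hrim a ((hmem a).2 (Or.inl rfl))
  obtain ⟨j, rfl⟩ := hrim b ((hmem b).2 (Or.inr rfl))
  refine ⟨i, j, fun h => hab (rim_eq_iff.2 h), fun s => ?_⟩
  rw [spoke, hmem, rim_eq_iff, rim_eq_iff]

/-- If two rim edges are off the cycle but a rim vertex between them is on it, then the cycle
uses two spokes between these edges. -/
lemma exists_two_spokes (hn : 3 ≤ n) (hc : c.IsCycle) {s i t : ℕ} (hsi : s < i) (hit : i ≤ t)
    (hs : rimEdge n s ∉ c.edges) (ht : rimEdge n t ∉ c.edges) (hi : rim n i ∈ c.support) :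
    ∃ a b, s < a ∧ a < b ∧ b ≤ t ∧ spoke n a ∈ c.edges ∧ spoke n b ∈ c.edges := by
  obtain ⟨w, hsw, hwt, hw⟩ : ∃ w, s < w ∧ w < t ∧ rimEdge n w ∈ c.edges := by
    obtain ⟨i, rfl⟩ := Nat.exists_eq_add_of_le' (show 1 ≤ i by omega)
    rcases edges_at_rim hn hc hi with h | h | h
    · refine ⟨i, lt_of_le_of_ne (by omega) ?_, by omega, h.1⟩
      rintro rfl
      exact hs h.1
    · refine ⟨i, lt_of_le_of_ne (by omega) ?_, by omega, h.1⟩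
      rintro rfl
      exact hs h.1
    · refine ⟨i + 1, hsi, lt_of_le_of_ne hit ?_, h.2.1⟩
      rintro rfl
      exact ht h.2.1
  have rise : ∀ w, s ≤ w → rimEdge n w ∈ c.edges → ∃ a, s < a ∧ a ≤ w ∧ spoke n a ∈ c.edges := by
    intro w hsw
    induction w, hsw using Nat.le_induction with
    | base => exact fun h => absurd h hs
    | succ w hsw ih =>
      intro hw
      by_cases h : rimEdge n w ∈ c.edges
      · obtain ⟨a, h1, h2, h3⟩ := ih h
        exact ⟨a, h1, by omega, h3⟩
      · have := edges_at_rim hn hc (rim_mem_support_of_rimEdge_mem hw).1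
        exact ⟨w + 1, by omega, le_rfl, by tauto⟩
  have fall : ∀ t, w ≤ t → rimEdge n t ∉ c.edges → ∃ b, w < b ∧ b ≤ t ∧ spoke n b ∈ c.edges := by
    intro t hwt
    induction t, hwt using Nat.le_induction with
    | base => exact fun h => absurd hw h
    | succ t hwt ih =>
      intro ht
      by_cases h : rimEdge n t ∈ c.edges
      · have := edges_at_rim hn hc (rim_mem_support_of_rimEdge_mem h).2
        exact ⟨t + 1, by omega, le_rfl, by tauto⟩
      · obtain ⟨a, h1, h2, h3⟩ := ih h
        exact ⟨a, h1, by omega, h3⟩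
  obtain ⟨a, h1, h2, h3⟩ := rise w hsw.le hw
  obtain ⟨b, h4, h5, h6⟩ := fall t hwt.le ht
  exact ⟨a, b, h1, by omega, h5, h3, h6⟩

lemma rimEdge_arc (hn : 3 ≤ n) (hc : c.IsCycle) {i d : ℕ}
    (hi : rim n i ∈ c.support) (hj : rim n (i + d) ∈ c.support) :
    (∀ t, i ≤ t → t < i + d → rimEdge n t ∈ c.edges) ∨
    (∀ t, i + d ≤ t → t < i + n → rimEdge n t ∈ c.edges) := by
  by_contra! h
  obtain ⟨⟨s, his, hsd, hs⟩, ⟨t, hdt, htn, ht⟩⟩ := h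
  obtain ⟨a, b, h1, h2, h3, ha, hb⟩ := exists_two_spokes hn hc hsd hdt hs ht hj
  obtain ⟨a', b', h1', h2', h3', ha', hb'⟩ := exists_two_spokes hn hc htn
    (Nat.add_le_add_right his n) ht (by rwa [rimEdge_periodic]) (by rwa [rim_periodic])
  obtain ⟨p, q, -, hpq⟩ := exists_spokes hc ha
  rw [hpq] at ha hb ha'
  have key : ∀ {x y r : ℕ}, x < y → y < x + n → x ≡ r [MOD n] → y ≡ r [MOD n] → False := by
    intro x y r hxy hyx hx hy
    exact hxy.ne (eq_of_modEq_of_lt (hx.trans hy.symm) hxy.le hyx)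
  rcases ha with ha | ha <;> rcases hb with hb | hb <;> rcases ha' with ha' | ha' <;>
  first
  | exact key (by omega) (by omega) ha hb
  | exact key (by omega) (by omega) ha ha'
  | exact key (by omega) (by omega) hb ha'

lemma rimEdge_mem_of_forall_spoke_not_mem (hn : 3 ≤ n) (hc : c.IsCycle) {i : ℕ}
    (hi : rim n i ∈ c.support) (h : ∀ t, spoke n t ∉ c.edges) (t : ℕ) :
    rimEdge n t ∈ c.edges := by
  by_contra ht
  obtain ⟨a, b, -, -, -, ha, -⟩ := exists_two_spokes hn hc (s := t) (i := i + (t + 1) * n)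
    (t := t + (t + i + 1) * n) (by nlinarith) (by nlinarith) ht
    (by rwa [(rimEdge_eq_iff hn).2 (show _ ≡ t [MOD n] by simp [Nat.ModEq])])
    (by rwa [rim_eq_iff.2 (show _ ≡ i [MOD n] by simp [Nat.ModEq])])
  exact h a ha

lemma card_add_card_le_length (hn : 3 ≤ n) (hc : c.IsCycle) {X Y : Finset ℕ} {i j : ℕ}
    (hX : X ⊆ Finset.Ico i (i + n)) (hY : Y ⊆ Finset.Ico j (j + n))
    (hXc : ∀ t ∈ X, rimEdge n t ∈ c.edges) (hYc : ∀ t ∈ Y, spoke n t ∈ c.edges) :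
    X.card + Y.card ≤ c.length := by
  have inj : ∀ {k s t : ℕ}, s ∈ Finset.Ico k (k + n) → t ∈ Finset.Ico k (k + n) →
      s ≡ t [MOD n] → s = t := by
    intro k s t hs ht h
    rw [Finset.mem_Ico] at hs ht
    rcases le_total s t with hst | hst
    · exact eq_of_modEq_of_lt h hst (by omega)
    · exact (eq_of_modEq_of_lt h.symm hst (by omega)).symm
  rw [← Finset.card_image_of_injOn (f := rimEdge n) (s := X)
      fun s hs t ht h => inj (hX hs) (hX ht) ((rimEdge_eq_iff hn).1 h),
    ← Finset.card_image_of_injOn (f := spoke n) (s := Y)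
      fun s hs t ht h => inj (hY hs) (hY ht) (spoke_eq_iff.1 h),
    ← Finset.card_union_of_disjoint, ← c.length_edges, ← List.toFinset_card_of_nodup hc.edges_nodup]
  · refine Finset.card_le_card fun e he => ?_
    simp only [Finset.mem_union, Finset.mem_image] at he
    obtain ⟨t, ht, rfl⟩ | ⟨t, ht, rfl⟩ := he
    · simpa using hXc t ht
    · simpa using hYc t ht
  · simp only [Finset.disjoint_left, Finset.mem_image]
    rintro e ⟨s, -, rfl⟩ ⟨t, -, h⟩
    exact rimEdge_ne_spoke s t h.symm

lemma card_add_two_le_length (hn : 3 ≤ n) (hc : c.IsCycle) (hlen : c.length < n) {i j : ℕ}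
    (hi : rim n i ∈ c.support) {X : Finset ℕ} (hX : X ⊆ Finset.Ico j (j + n))
    (hXc : ∀ t ∈ X, rimEdge n t ∈ c.edges) : X.card + 2 ≤ c.length := by
  by_cases h : ∀ t, spoke n t ∉ c.edges
  · have := card_add_card_le_length hn hc (X := Finset.Ico 0 (0 + n)) (Y := ∅) (i := 0) (j := 0)
      subset_rfl (by simp) (fun t _ => rimEdge_mem_of_forall_spoke_not_mem hn hc hi h t) (by simp)
    simp at this
    omega
  · push Not at h
    obtain ⟨t, ht⟩ := h
    obtain ⟨p, q, hpq, hs⟩ := exists_spokes hc ht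
    have hpos : 0 < n := by omega
    rw [← Finset.card_pair (a := p % n) (b := q % n) hpq]
    refine card_add_card_le_length hn hc (j := 0) hX ?_ hXc ?_
    · simp [Finset.insert_subset_iff, Nat.mod_lt _ hpos]
    · simp [hs, Nat.mod_modEq]

lemma half_add_two_le_length (hn : 4 ≤ n) (hc : c.IsCycle) (h0 : rim n 0 ∈ c.support)
    (h1 : rim n (n / 2) ∈ c.support) : n / 2 + 2 ≤ c.length := by
  by_contra! hlen
  rcases rimEdge_arc (by omega) hc (i := 0) (d := n / 2) h0 (by simpa using h1) with h | h
  · have := card_add_two_le_length (by omega) hc (by omega) h0 (j := 0)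
      (X := Finset.Ico 0 (n / 2)) (Finset.Ico_subset_Ico le_rfl (by omega))
      (fun t ht => by rw [Finset.mem_Ico] at ht; exact h t ht.1 (by omega))
    simp at this
    omega
  · have := card_add_two_le_length (by omega) hc (by omega) h0 (j := 0)
      (X := Finset.Ico (n / 2) n) (Finset.Ico_subset_Ico (by omega) (by omega))
      (fun t ht => by rw [Finset.mem_Ico] at ht; exact h t (by omega) (by omega))
    simp at this
    omega

lemma edges_of_length_le {k : ℕ} (hn : n = 2 * k + 1) (hk : 2 ≤ k) (hc : c.IsCycle)
    (hlen : c.length ≤ k + 2) {i : ℕ} (hi : rim n i ∈ c.support)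
    (hj : rim n (i + k) ∈ c.support) :
    (∀ t, i ≤ t → t < i + k → rimEdge n t ∈ c.edges) ∧ spoke n i ∈ c.edges ∧
      spoke n (i + k) ∈ c.edges := by
  have bound : ∀ {j : ℕ} {X : Finset ℕ}, X ⊆ Finset.Ico j (j + n) →
      (∀ t ∈ X, rimEdge n t ∈ c.edges) → X.card ≤ k := fun hX hXc => by
    have := card_add_two_le_length (by omega) hc (by omega) hi hX hXc
    omega
  have harc : ∀ t, i ≤ t → t < i + k → rimEdge n t ∈ c.edges := by
    refine (rimEdge_arc (by omega) hc hi hj).resolve_right fun h => ?_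
    have := bound (j := i) (X := Finset.Ico (i + k) (i + n))
      (Finset.Ico_subset_Ico (by omega) (by omega))
      (fun t ht => by rw [Finset.mem_Ico] at ht; exact h t (by omega) (by omega))
    simp at this
    omega
  have hout : ∀ t, i + k ≤ t → t < i + n → rimEdge n t ∉ c.edges := by
    intro t h1 h2 h
    have := bound (j := i) (X := insert t (Finset.Ico i (i + k)))
      (by
        intro s hs
        simp only [Finset.mem_insert, Finset.mem_Ico] at hs ⊢
        omega)
      (by
        intro s hs
        simp only [Finset.mem_insert, Finset.mem_Ico] at hs
        obtain rfl | hs := hs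
        · exact h
        · exact harc s hs.1 hs.2)
    rw [Finset.card_insert_of_notMem (by simp; omega)] at this
    simp at this
  refine ⟨harc, ?_, ?_⟩
  · have h1 := hout (i + n - 1) (by omega) (by omega)
    have h2 := harc i le_rfl (by omega)
    rw [← rim_periodic] at hi
    rw [← rimEdge_periodic] at h2
    rw [← spoke_periodic]
    rw [show i + n = i + n - 1 + 1 by omega] at hi h2 ⊢
    have := edges_at_rim (by omega) hc hi
    tauto
  · have h1 := hout (i + k) (by omega) (by omega)
    have h2 := harc (i + k - 1) (by omega) (by omega)
    rw [show i + k = i + k - 1 + 1 by omega] at hj h1 ⊢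
    have := edges_at_rim (by omega) hc hj
    tauto

end Cycle

lemma length_le_of_rainbow {V : Type*} {G : SimpleGraph V} {φ : Sym2 V → ℕ} {r : ℕ}
    (hφ : ∀ e ∈ G.edgeSet, φ e < r) {u : V} {c : G.Walk u u} (hc : (c.edges.map φ).Nodup) :
    c.length ≤ r := by
  rw [← c.length_edges, ← List.length_map φ, ← List.toFinset_card_of_nodup hc,
    ← Finset.card_range r]
  refine Finset.card_le_card fun x hx => ?_
  simp only [List.mem_toFinset, List.mem_map] at hx
  obtain ⟨e, he, rfl⟩ := hx
  simpa using hφ e (c.edges_subset_edgeSet he)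

lemma exists_rainbow_cycle {V : Type*} {G : SimpleGraph V} {φ : Sym2 V → ℕ}
    (h : G.IsRainbowCycleColoring 2 φ) {v w : V} (hvw : v ≠ w) :
    ∃ (u : V) (c : G.Walk u u), c.IsCycle ∧ v ∈ c.support ∧ w ∈ c.support ∧
      (c.edges.map φ).Nodup := by
  classical
  obtain ⟨u, c, hc, hs, hr⟩ := h {v, w} (Finset.card_pair hvw)
  exact ⟨u, c, hc, hs v (by simp), hs w (by simp), hr⟩

/-- A cyclic sequence of `2k + 1` rim colours `e` and spoke colours `s`, with only `k + 2` colours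
in total, has an arc of `k` rim edges that is not rainbow together with its two end spokes. -/
lemma no_rainbow_arcs {k : ℕ} (hk : 2 ≤ k) {e s : ℕ → ℕ}
    (he : ∀ t, e (t + (2 * k + 1)) = e t) (hs : ∀ t, s (t + (2 * k + 1)) = s t)
    (he' : ∀ t, e t < k + 2) (hs' : ∀ t, s t < k + 2)
    (hee : ∀ i a b, i ≤ a → a < b → b < i + k → e a ≠ e b)
    (hes : ∀ i a, i ≤ a → a < i + k → e a ≠ s i ∧ e a ≠ s (i + k))
    (hss : ∀ i, s i ≠ s (i + k)) : False := by
  have cover : ∀ i x, x < k + 2 → x = s i ∨ x = s (i + k) ∨ ∃ t, i ≤ t ∧ t < i + k ∧ x = e t := by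
    intro i x hx
    have hcard : (insert (s i) (insert (s (i + k)) ((Finset.Ico i (i + k)).image e))).card
        = k + 2 := by
      rw [Finset.card_insert_of_notMem, Finset.card_insert_of_notMem,
        Finset.card_image_of_injOn]
      · simp
      · intro a ha b hb hab
        simp only [Finset.coe_Ico, Set.mem_Ico] at ha hb
        rcases lt_trichotomy a b with h | h | h
        · exact absurd hab (hee i a b ha.1 h hb.2)
        · exact h
        · exact absurd hab.symm (hee i b a hb.1 h ha.2)
      · simp only [Finset.mem_image, Finset.mem_Ico, not_exists, not_and]
        exact fun a ha => (hes i a ha.1 ha.2).2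
      · simp only [Finset.mem_insert, Finset.mem_image, Finset.mem_Ico, not_or, not_exists, not_and]
        exact ⟨hss i, fun a ha => (hes i a ha.1 ha.2).1⟩
    have hsub : insert (s i) (insert (s (i + k)) ((Finset.Ico i (i + k)).image e))
        ⊆ Finset.range (k + 2) := by
      intro y hy
      simp only [Finset.mem_insert, Finset.mem_image, Finset.mem_range] at hy ⊢
      obtain rfl | rfl | ⟨t, -, rfl⟩ := hy
      exacts [hs' _, hs' _, he' _]
    have hx' := Finset.mem_range.2 hx
    rw [← Finset.eq_of_subset_of_card_le hsub (by rw [hcard, Finset.card_range])] at hx'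
    simp only [Finset.mem_insert, Finset.mem_image, Finset.mem_Ico] at hx'
    obtain h | h | ⟨t, ht, h⟩ := hx'
    exacts [Or.inl h, Or.inr (Or.inl h), Or.inr (Or.inr ⟨t, ht.1, ht.2, h.symm⟩)]
  have off : ∀ j t, j ≤ t → t < j + (2 * k + 1) → t ≠ j + k → e t ≠ s j := by
    intro j t h1 h2 h3
    by_cases h : t < j + k
    · exact (hes j t h1 h).1
    · have := (hes (j + k + 1) t (by omega) (by omega)).2
      rwa [show j + k + 1 + k = j + (2 * k + 1) by ring, hs] at this
  have uniq : ∀ i j, i < j → j < i + (2 * k + 1) → e (i + k) = s i → s j ≠ s i := by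
    intro i j h1 h2 h3 h4
    rw [← h4] at h3
    by_cases h : j ≤ i + k
    · exact off j (i + k) h (by omega) (by omega) h3
    · rw [← he] at h3
      exact off j _ (by omega) (by omega) (by omega) h3
  have not_special : ∀ i, e (i + k) ≠ s i := by
    suffices H : ∀ j, e (j + k + k) ≠ s (j + k) by
      intro i h
      apply H (i + k + 1)
      rwa [show i + k + 1 + k + k = i + k + (2 * k + 1) by ring,
        show i + k + 1 + k = i + (2 * k + 1) by ring, he, hs]
    intro j h
    obtain h' | h' | ⟨t, h1, h2, h'⟩ := cover (j + 1) (s (j + k)) (hs' _)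
    · refine uniq (j + k) (j + 1 + (2 * k + 1)) (by omega) (by omega) h ?_
      rw [hs, h']
    · exact uniq (j + k) (j + 1 + k) (by omega) (by omega) h h'.symm
    · by_cases ht : t < j + k
      · exact (hes j t (by omega) ht).2 h'.symm
      · exact (hes (j + k) t (by omega) (by omega)).1 h'.symm
  have step : ∀ i, e (i + k) = e i := by
    intro i
    obtain h | h | ⟨t, h1, h2, h⟩ := cover i (e (i + k)) (he' _)
    · exact absurd h (not_special i)
    · exact absurd h (hes (i + k) _ le_rfl (by omega)).1
    · obtain rfl | h1 := h1.eq_or_lt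
      · exact h
      · exact absurd h.symm (hee (i + 1) t (i + k) h1 h2 (by omega))
  have h1 := step 0
  have h2 := step (0 + k)
  have h3 := he 0
  exact hee (0 + k + k) (0 + k + k) (0 + (2 * k + 1)) le_rfl (by omega) (by omega)
    (by rw [h3, h2, h1])

lemma half_add_two_le (hn : 4 ≤ n) {φ : Sym2 (Option (Fin n)) → ℕ} {r : ℕ}
    (hφ : ∀ e ∈ (wheelGraph n).edgeSet, φ e < r)
    (h : (wheelGraph n).IsRainbowCycleColoring 2 φ) : n / 2 + 2 ≤ r := by
  have hne : rim n 0 ≠ rim n (n / 2) := fun h => by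
    have := eq_of_modEq_of_lt (rim_eq_iff.1 h) (by omega) (by omega)
    omega
  obtain ⟨u, c, hc, h0, h1, hr⟩ := exists_rainbow_cycle h hne
  exact (half_add_two_le_length hn hc h0 h1).trans (length_le_of_rainbow hφ hr)

lemma add_three_le_of_odd {k : ℕ} (hn : n = 2 * k + 1) (hk : 2 ≤ k)
    {φ : Sym2 (Option (Fin n)) → ℕ} {r : ℕ} (hφ : ∀ e ∈ (wheelGraph n).edgeSet, φ e < r)
    (h : (wheelGraph n).IsRainbowCycleColoring 2 φ) : k + 3 ≤ r := by
  by_contra! hr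
  have key : ∀ i, ∃ (u : _) (c : (wheelGraph n).Walk u u),
      ((∀ t, i ≤ t → t < i + k → rimEdge n t ∈ c.edges) ∧ spoke n i ∈ c.edges ∧
      spoke n (i + k) ∈ c.edges) ∧ ∀ e ∈ c.edges, ∀ f ∈ c.edges, φ e = φ f → e = f := by
    intro i
    have hne : rim n i ≠ rim n (i + k) := fun h => by
      have := eq_of_modEq_of_lt (rim_eq_iff.1 h) (by omega) (by omega)
      omega
    obtain ⟨u, c, hc, h0, h1, hnd⟩ := exists_rainbow_cycle h hne
    have hlen := length_le_of_rainbow hφ hnd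
    exact ⟨u, c, edges_of_length_le hn hk hc (by omega) h0 h1,
      fun e he f hf => List.inj_on_of_nodup_map hnd he hf⟩
  refine no_rainbow_arcs hk (e := fun t => φ (rimEdge n t)) (s := fun t => φ (spoke n t))
    ?_ ?_ ?_ ?_ ?_ ?_ ?_
  · intro t
    rw [← hn, rimEdge_periodic]
  · intro t
    rw [← hn, spoke_periodic]
  · exact fun t => (hφ (rimEdge n t) (adj_rim_succ (by omega) t)).trans_le (by omega)
  · exact fun t => (hφ (spoke n t) (adj_none_rim t)).trans_le (by omega)
  · intro i a b h1 h2 h3 hab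
    obtain ⟨u, c, ⟨harc, -, -⟩, hinj⟩ := key i
    have := hinj _ (harc a h1 (by omega)) _ (harc b (by omega) h3) hab
    have := eq_of_modEq_of_lt ((rimEdge_eq_iff (by omega)).1 this) (by omega) (by omega)
    omega
  · intro i a h1 h2
    obtain ⟨u, c, ⟨harc, hs, hs'⟩, hinj⟩ := key i
    exact ⟨fun h => rimEdge_ne_spoke _ _ (hinj _ (harc a h1 h2) _ hs h),
      fun h => rimEdge_ne_spoke _ _ (hinj _ (harc a h1 h2) _ hs' h)⟩
  · intro i h
    obtain ⟨u, c, ⟨-, hs, hs'⟩, hinj⟩ := key i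
    have := eq_of_modEq_of_lt (spoke_eq_iff.1 (hinj _ hs _ hs' h)) (by omega) (by omega)
    omega

/-- The walk along `h` rim edges starting at `rim n a`. -/
def rimWalk (hn : 2 ≤ n) (a : ℕ) : (h : ℕ) → (wheelGraph n).Walk (rim n a) (rim n (a + h))
  | 0 => Walk.nil
  | h + 1 => (rimWalk hn a h).concat (adj_rim_succ hn (a + h))

lemma support_rimWalk (hn : 2 ≤ n) (a h : ℕ) :
    (rimWalk hn a h).support = (List.range (h + 1)).map fun t => rim n (a + t) := by
  induction h with
  | zero => rfl
  | succ h ih =>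
    rw [rimWalk, Walk.support_concat, ih, List.range_succ (n := h + 1)]
    simp

lemma edges_rimWalk (hn : 2 ≤ n) (a h : ℕ) :
    (rimWalk hn a h).edges = (List.range h).map fun t => rimEdge n (a + t) := by
  induction h with
  | zero => rfl
  | succ h ih =>
    rw [rimWalk, Walk.edges_concat, ih, List.range_succ]
    simp [rimEdge, add_assoc]

/-- The cycle through the centre and the `h + 1` consecutive rim vertices from `rim n a`. -/
def fan (hn : 2 ≤ n) (a h : ℕ) : (wheelGraph n).Walk none none :=
  Walk.cons (adj_none_rim a) ((rimWalk hn a h).concat (adj_none_rim (a + h)).symm)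

lemma isCycle_fan (hn : 2 ≤ n) (a : ℕ) {h : ℕ} (h1 : 1 ≤ h) (h2 : h < n) :
    (fan hn a h).IsCycle := by
  have hnd : (rimWalk hn a h).support.Nodup := by
    rw [support_rimWalk]
    refine List.Nodup.map_on ?_ List.nodup_range
    intro s hs t ht hst
    rw [List.mem_range] at hs ht
    have := rim_eq_iff.1 hst
    rcases le_total s t with h | h
    · have := eq_of_modEq_of_lt this (by omega) (by omega)
      omega
    · have := eq_of_modEq_of_lt this.symm (by omega) (by omega)
      omega
  rw [fan, Walk.cons_isCycle_iff]
  constructor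
  · rw [Walk.isPath_def, Walk.support_concat, List.nodup_append]
    refine ⟨hnd, by simp, ?_⟩
    simp [support_rimWalk, rim_ne_none]
  · rw [Walk.edges_concat, edges_rimWalk]
    simp only [List.concat_eq_append, List.mem_append, List.mem_map, List.mem_range,
      List.mem_singleton, not_or, not_exists, not_and]
    refine ⟨fun t _ => rimEdge_ne_spoke _ _, fun h' => ?_⟩
    rw [Sym2.eq_swap (a := rim n (a + h))] at h'
    have := eq_of_modEq_of_lt (spoke_eq_iff.1 h') (by omega) (by omega)
    omega

lemma rim_mem_support_fan (hn : 2 ≤ n) {a h t : ℕ} (h1 : a ≤ t) (h2 : t ≤ a + h) :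
    rim n t ∈ (fan hn a h).support := by
  rw [fan, Walk.support_cons, Walk.support_concat, support_rimWalk]
  simp only [List.mem_cons, List.mem_append, List.mem_map, List.mem_range]
  exact Or.inr (Or.inl ⟨t - a, by omega, by rw [Nat.add_sub_cancel' h1]⟩)

lemma edges_fan (hn : 2 ≤ n) (a h : ℕ) : (fan hn a h).edges =
    spoke n a :: ((List.range h).map (fun t => rimEdge n (a + t)) ++ [spoke n (a + h)]) := by
  rw [fan, Walk.edges_cons, Walk.edges_concat, edges_rimWalk, List.concat_eq_append,
    Sym2.eq_swap (a := rim n (a + h))]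
  rfl

lemma exists_fan (hn : 2 ≤ n) {h : ℕ} (hh : n ≤ 2 * h + 1) {v w : Option (Fin n)} (hvw : v ≠ w) :
    ∃ a < n, v ∈ (fan hn a h).support ∧ w ∈ (fan hn a h).support := by
  have hnone : ∀ a, none ∈ (fan hn a h).support := fun a => Walk.start_mem_support _
  obtain rfl | ⟨i, hi, rfl⟩ := eq_none_or_eq_rim v
  · obtain rfl | ⟨j, hj, rfl⟩ := eq_none_or_eq_rim w
    · exact absurd rfl hvw
    · exact ⟨j, hj, hnone _, rim_mem_support_fan hn le_rfl (by omega)⟩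
  · obtain rfl | ⟨j, hj, rfl⟩ := eq_none_or_eq_rim w
    · exact ⟨i, hi, rim_mem_support_fan hn le_rfl (by omega), hnone _⟩
    · by_cases h1 : i ≤ j ∧ j ≤ i + h
      · exact ⟨i, hi, rim_mem_support_fan hn le_rfl (by omega), rim_mem_support_fan hn h1.1 h1.2⟩
      by_cases h2 : j ≤ i ∧ i ≤ j + h
      · exact ⟨j, hj, rim_mem_support_fan hn h2.1 h2.2, rim_mem_support_fan hn le_rfl (by omega)⟩
      rcases le_total i j with hij | hij
      · refine ⟨j, hj, ?_, rim_mem_support_fan hn le_rfl (by omega)⟩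
        rw [← rim_periodic]
        exact rim_mem_support_fan hn (by omega) (by omega)
      · refine ⟨i, hi, rim_mem_support_fan hn le_rfl (by omega), ?_⟩
        rw [← rim_periodic]
        exact rim_mem_support_fan hn (by omega) (by omega)

lemma exists_coloring (hn : 3 ≤ n) {r : ℕ} {e s : ℕ → ℕ} (he : ∀ t < n, e t < r)
    (hs : ∀ t < n, s t < r) :
    ∃ φ : Sym2 (Option (Fin n)) → ℕ, (∀ x, φ x < r) ∧ (∀ t, φ (rimEdge n t) = e (t % n)) ∧
      ∀ t, φ (spoke n t) = s (t % n) := by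
  classical
  have hpos : 0 < n := by omega
  have hr : 0 < r := (Nat.zero_le _).trans_lt (he 0 hpos)
  have mod_eq : ∀ {a b : ℕ}, a ≡ b [MOD n] → a % n = b % n := id
  refine ⟨fun x => if h : ∃ t, x = rimEdge n t then e (h.choose % n) else
    if h : ∃ t, x = spoke n t then s (h.choose % n) else 0, fun x => ?_, fun t => ?_, fun t => ?_⟩
  · dsimp only
    split_ifs
    exacts [he _ (Nat.mod_lt _ hpos), hs _ (Nat.mod_lt _ hpos), hr]
  · have h : ∃ t', rimEdge n t = rimEdge n t' := ⟨t, rfl⟩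
    dsimp only
    rw [dif_pos h, mod_eq ((rimEdge_eq_iff hn).1 h.choose_spec)]
  · have h : ∃ t', spoke n t = spoke n t' := ⟨t, rfl⟩
    have h' : ¬ ∃ t', spoke n t = rimEdge n t' := fun ⟨t', ht⟩ => rimEdge_ne_spoke _ _ ht.symm
    dsimp only
    rw [dif_neg h', dif_pos h, mod_eq (spoke_eq_iff.1 h.choose_spec)]

lemma exists_rainbow_coloring (hn : 3 ≤ n) {r h : ℕ} (h1 : 1 ≤ h) (hhn : h < n)
    (hh : n ≤ 2 * h + 1) {e s : ℕ → ℕ} (he : ∀ t < n, e t < r) (hs : ∀ t < n, s t < r)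
    (hee : ∀ a < n, ∀ t t', a ≤ t → t < t' → t' < a + h → e (t % n) ≠ e (t' % n))
    (hes : ∀ a < n, ∀ t, a ≤ t → t < a + h →
      e (t % n) ≠ s a ∧ e (t % n) ≠ s ((a + h) % n))
    (hss : ∀ a < n, s a ≠ s ((a + h) % n)) :
    ∃ φ : Sym2 (Option (Fin n)) → ℕ, (∀ x ∈ (wheelGraph n).edgeSet, φ x < r) ∧
      (wheelGraph n).IsRainbowCycleColoring 2 φ := by
  obtain ⟨φ, hr, hφe, hφs⟩ := exists_coloring hn he hs
  refine ⟨φ, fun x _ => hr x, fun S hS => ?_⟩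
  obtain ⟨v, w, hvw, rfl⟩ := Finset.card_eq_two.1 hS
  have hn2 : 2 ≤ n := by omega
  obtain ⟨a, ha, hv, hw⟩ := exists_fan hn2 hh hvw
  refine ⟨none, fan hn2 a h, isCycle_fan hn2 a h1 hhn, by simp [hv, hw], ?_⟩
  rw [edges_fan]
  simp only [List.map_cons, List.map_append, List.map_map, List.map_nil, List.nodup_cons,
    List.mem_append, List.mem_map, List.mem_range, List.mem_singleton, List.nodup_append,
    Function.comp_apply, hφe, hφs, Nat.mod_eq_of_lt ha]
  refine ⟨?_, ?_, by simp, ?_⟩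
  · rintro (⟨t, ht, h⟩ | h)
    · exact (hes a ha (a + t) (by omega) (by omega)).1 h
    · exact hss a ha h
  · refine List.Nodup.map_on ?_ List.nodup_range
    intro t ht t' ht' h
    rw [List.mem_range] at ht ht'
    simp only [Function.comp_apply, hφe] at h
    rcases lt_trichotomy t t' with hlt | hlt | hlt
    · exact absurd h (hee a ha _ _ (by omega) (by omega) (by omega))
    · exact hlt
    · exact absurd h.symm (hee a ha _ _ (by omega) (by omega) (by omega))
  · rintro x ⟨t, ht, rfl⟩ y rfl
    exact (hes a ha (a + t) (by omega) (by omega)).2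

lemma exists_rainbow_coloring_half (hn : 4 ≤ n) :
    ∃ φ : Sym2 (Option (Fin n)) → ℕ,
      (∀ x ∈ (wheelGraph n).edgeSet, φ x < (n + 1) / 2 + 2) ∧
        (wheelGraph n).IsRainbowCycleColoring 2 φ := by
  obtain ⟨m, hm⟩ : ∃ m, m = (n + 1) / 2 := ⟨_, rfl⟩
  rw [← hm]
  have mod_n : ∀ t, t < 2 * n → t % n = if t < n then t else t - n := by
    intro t ht
    split_ifs with h
    · exact Nat.mod_eq_of_lt h
    · rw [Nat.mod_eq_sub_mod (by omega), Nat.mod_eq_of_lt (by omega)]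
  refine exists_rainbow_coloring (h := n / 2) (e := fun t => if t < m then t else t - m)
    (s := fun t => if t = 0 then n / 2 else if t < m then m else m + 1)
    (by omega) (by omega) (by omega) (by omega) ?_ ?_ ?_ ?_ ?_
  · intro t ht
    split_ifs <;> omega
  · intro t ht
    split_ifs <;> omega
  · intro a ha t t' h1 h2 h3
    rw [mod_n t (by omega), mod_n t' (by omega)]
    split_ifs <;> omega
  · intro a ha t h1 h2
    rw [mod_n t (by omega), mod_n (a + n / 2) (by omega)]
    constructor <;> split_ifs <;> omega
  · intro a ha
    rw [mod_n (a + n / 2) (by omega)]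
    split_ifs <;> omega

lemma exists_rainbow_coloring_three :
    ∃ φ : Sym2 (Option (Fin 3)) → ℕ, (∀ x ∈ (wheelGraph 3).edgeSet, φ x < 3) ∧
      (wheelGraph 3).IsRainbowCycleColoring 2 φ := by
  refine exists_rainbow_coloring (h := 1) (e := fun t => t) (s := fun t => (t + 1) % 3)
    le_rfl le_rfl (by omega) le_rfl ?_ ?_ ?_ ?_ ?_ <;> intros <;> omega

end Wheel

/-- crx_2(W_n) = ⌈n/2⌉ + 2 for n ≥ 4, and crx_2(W_3) = 3. -/
theorem crx_two_wheel :
    (∀ n : ℕ, 4 ≤ n → (wheelGraph n).crx 2 = (n + 1) / 2 + 2) ∧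
      (wheelGraph 3).crx 2 = 3 := by
  constructor
  · intro n hn
    have : NeZero n := ⟨by omega⟩
    have hmem := Wheel.exists_rainbow_coloring_half hn
    refine le_antisymm (Nat.sInf_le hmem) (le_csInf ⟨_, hmem⟩ ?_)
    rintro r ⟨φ, hφ, h⟩
    obtain ⟨k, hk | hk⟩ := Nat.even_or_odd' n
    · have := Wheel.half_add_two_le hn hφ h
      omega
    · have := Wheel.add_three_le_of_odd hk (by omega) hφ h
      omega
  · have hmem := Wheel.exists_rainbow_coloring_three
    refine le_antisymm (Nat.sInf_le hmem) (le_csInf ⟨_, hmem⟩ ?_)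
    rintro r ⟨φ, hφ, h⟩
    obtain ⟨u, c, hc, -, -, hr⟩ := Wheel.exists_rainbow_cycle h
      (Wheel.none_ne_rim (n := 3) 0)
    exact hc.three_le_length.trans (Wheel.length_le_of_rainbow hφ hr)
end

section
/- For k ≥ 4 and n ≥ 2k, crx_k(W_n) = n, and for k ≥ 4 and k − 1 ≤ n < 2k, crx_k(W_n) = n + 1, where W_n is the wheel on n+1 vertices. -/
open SimpleGraph

namespace wheelGraph

/-- A natural number is determined modulo `n` up to a multiple of `n`. -/
lemma add_le_of_natCast_eq {n a b : ℕ} (h : (a : ZMod n) = b) (hab : a < b) : a + n ≤ b := by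
  have h1 := (Nat.modEq_iff_dvd' hab.le).mp ((ZMod.natCast_eq_natCast_iff a b n).mp h)
  have := Nat.le_of_dvd (by omega) h1
  omega

lemma eq_of_add_natCast_eq {n a b : ℕ} {x : ZMod n} (h : x + a = x + b) (ha : a < n)
    (hb : b < n) : a = b := by
  have h := add_left_cancel h
  rcases lt_trichotomy a b with hab | hab | hab
  · have := add_le_of_natCast_eq h hab
    omega
  · exact hab
  · have := add_le_of_natCast_eq h.symm hab
    omega

lemma exists_eq_add_natCast {n : ℕ} [NeZero n] (x y : ZMod n) : ∃ t < n, y = x + (t : ℕ) :=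
  ⟨(y - x).val, ZMod.val_lt _, by simp⟩

/-- A sequence of unit steps that never turns back moves in a constant direction. -/
lemma exists_direction {n : ℕ} {x : ℕ → ZMod n} {l : ℕ}
    (hstep : ∀ i, i + 1 < l → x (i + 1) - x i = 1 ∨ x (i + 1) - x i = -1)
    (hback : ∀ i, i + 2 < l → x i ≠ x (i + 2)) :
    ∃ ε : ZMod n, (ε = 1 ∨ ε = -1) ∧ ∀ i < l, x i = x 0 + i * ε := by
  by_cases hl : 1 < l
  · refine ⟨x 1 - x 0, hstep 0 hl, fun i hi => ?_⟩
    have hconst : ∀ i, i + 1 < l → x (i + 1) - x i = x 1 - x 0 := by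
      intro i
      induction i with
      | zero => simp
      | succ i ih =>
        intro hi
        rw [← ih (by omega)]
        have hb := hback i hi
        rcases hstep i (by omega) with h1 | h1 <;> rcases hstep (i + 1) hi with h2 | h2
        · rw [h1, h2]
        · exact (hb (by linear_combination -h1 - h2)).elim
        · exact (hb (by linear_combination -h1 - h2)).elim
        · rw [h1, h2]
    induction i with
    | zero => simp
    | succ i ih =>
      push_cast
      linear_combination ih (by omega) + hconst i hi
  · refine ⟨1, Or.inl rfl, fun i hi => ?_⟩
    obtain rfl : i = 0 := by omega
    simp

/-- The arc from `q` to `q + d` is closed under `f`: both its endpoints are sent to edge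
positions inside it. -/
def IsGood {n : ℕ} (f : ZMod n → ZMod n) (q : ZMod n) (d : ℕ) : Prop :=
  2 ≤ d ∧ (∃ i < d, f q = q + (i : ZMod n)) ∧ ∃ j < d, f (q + (d : ZMod n)) = q + (j : ZMod n)

/-- A good arc containing no shorter good arc. -/
def IsMinimalGood {n : ℕ} (f : ZMod n → ZMod n) (q : ZMod n) (d : ℕ) : Prop :=
  IsGood f q d ∧ ∀ t e : ℕ, t + e ≤ d → IsGood f (q + (t : ZMod n)) e → e = d

lemma IsGood.exists_isMinimalGood {n : ℕ} {f : ZMod n → ZMod n} {q : ZMod n} {d : ℕ}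
    (h : IsGood f q d) :
    ∃ t e : ℕ, t + e ≤ d ∧ IsMinimalGood f (q + (t : ZMod n)) e := by
  induction d using Nat.strong_induction_on generalizing q with
  | _ d ih =>
    by_cases hmin : IsMinimalGood f q d
    · exact ⟨0, d, by omega, by simpa using hmin⟩
    · simp only [IsMinimalGood, h, true_and] at hmin
      push Not at hmin
      obtain ⟨t, e, hte, hgood, hne⟩ := hmin
      obtain ⟨s, e', hse, hmin⟩ := ih e (by omega) hgood
      refine ⟨t + s, e', by omega, ?_⟩
      push_cast
      rwa [← add_assoc]

/-- A set of at most `max 3 (n / 2)` vertices meets the interior of every good arc. -/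
lemma exists_hitting_set {n : ℕ} [NeZero n] (f : ZMod n → ZMod n) {l : ℕ} (h3 : 3 ≤ l)
    (hl : n ≤ 2 * l + 1) :
    ∃ S : Finset (ZMod n), S.card ≤ l ∧
      ∀ q d, IsGood f q d → ∃ t : ℕ, 0 < t ∧ t < d ∧ q + (t : ZMod n) ∈ S := by
  classical
  suffices h : ∃ S : Finset (ZMod n), S.card ≤ l ∧
      ∀ q d, IsMinimalGood f q d → ∃ t : ℕ, 0 < t ∧ t < d ∧ q + (t : ZMod n) ∈ S by
    obtain ⟨S, hS, hit⟩ := h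
    refine ⟨S, hS, fun q d hgood => ?_⟩
    obtain ⟨s, e, hse, hmin⟩ := hgood.exists_isMinimalGood
    obtain ⟨t, ht0, hte, ht⟩ := hit _ _ hmin
    refine ⟨s + t, by omega, by omega, ?_⟩
    push_cast
    rwa [← add_assoc]
  by_cases hshare : ∃ q d e, IsMinimalGood f q d ∧ IsMinimalGood f (q + (d : ZMod n)) e
  · obtain ⟨q, d, e, hd, he⟩ := hshare
    obtain ⟨⟨hd2, -, j, hj, hfj⟩, hdmin⟩ := hd
    obtain ⟨⟨he2, ⟨i, hi, hfi⟩, -⟩, hemin⟩ := he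
    have hwrap : n + 1 ≤ d + e := by
      have h0 : (j : ZMod n) = ((d + i : ℕ) : ZMod n) := by
        push_cast
        linear_combination hfi - hfj
      have := add_le_of_natCast_eq h0 (by omega)
      omega
    refine ⟨{q + ((d - 1 : ℕ) : ZMod n), q + (d : ZMod n) + ((e - 1 : ℕ) : ZMod n),
      q + (d : ZMod n)}, Finset.card_le_three.trans h3, fun x a hx => ?_⟩
    have ha2 := hx.1.1
    obtain ⟨t, htn, rfl⟩ := exists_eq_add_natCast q x
    rcases lt_trichotomy (t + 1) d with ht | ht | ht
    · have hlong : d - 1 - t < a := by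
        by_contra hcon
        have := hdmin t a (by omega) hx.1
        omega
      refine ⟨d - 1 - t, by omega, hlong, ?_⟩
      rw [add_assoc q (t : ZMod n), ← Nat.cast_add, show t + (d - 1 - t) = d - 1 by omega]
      simp
    · refine ⟨1, by omega, by omega, ?_⟩
      rw [add_assoc q (t : ZMod n), ← Nat.cast_add, ht]
      simp
    · have hxt : q + (t : ZMod n) = q + (d : ZMod n) + ((t - d : ℕ) : ZMod n) := by
        rw [add_assoc, ← Nat.cast_add, show d + (t - d) = t by omega]
      rw [hxt] at hx ⊢
      have hlong : e - 1 - (t - d) < a := by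
        by_contra hcon
        have := hemin (t - d) a (by omega) hx.1
        omega
      refine ⟨e - 1 - (t - d), by omega, hlong, ?_⟩
      rw [add_assoc _ (((t - d : ℕ)) : ZMod n), ← Nat.cast_add,
        show t - d + (e - 1 - (t - d)) = e - 1 by omega]
      simp
  · have hleft : ∀ q d e, IsMinimalGood f q d → IsMinimalGood f q e → d = e := by
      intro q d e hd he
      rcases le_total d e with h | h
      · exact he.2 0 d (by omega) (by simpa using hd.1)
      · exact (hd.2 0 e (by omega) (by simpa using he.1)).symm
    have hright : ∀ q d q' d', IsMinimalGood f q d → IsMinimalGood f q' d' →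
        d ≤ d' → q + (d : ZMod n) = q' + (d' : ZMod n) → q = q' := by
      intro q d q' d' hd hd' hle heq
      have hq : q = q' + ((d' - d : ℕ) : ZMod n) := by
        rw [Nat.cast_sub hle]
        linear_combination heq
      have := hd'.2 (d' - d) d (by omega) (hq ▸ hd.1)
      subst this
      simpa using heq
    let L : Finset (ZMod n) := Finset.univ.filter fun q => ∃ d, IsMinimalGood f q d
    have hL : ∀ q, q ∈ L ↔ ∃ d, IsMinimalGood f q d := by simp [L]
    have hex : ∀ q, ∃ d, q ∈ L → IsMinimalGood f q d := by
      intro q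
      by_cases h : q ∈ L
      · obtain ⟨d, hd⟩ := (hL q).mp h
        exact ⟨d, fun _ => hd⟩
      · exact ⟨0, fun h' => (h h').elim⟩
    choose D hD using hex
    have hRcard : (L.image fun q => q + (D q : ZMod n)).card = L.card := by
      refine Finset.card_image_of_injOn fun q hq q' hq' heq => ?_
      rcases le_total (D q) (D q') with h | h
      · exact hright _ _ _ _ (hD q hq) (hD q' hq') h heq
      · exact (hright _ _ _ _ (hD q' hq') (hD q hq) h heq.symm).symm
    have hdisj : Disjoint L (L.image fun q => q + (D q : ZMod n)) := by
      refine Finset.disjoint_right.mpr fun p hp hpL => ?_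
      obtain ⟨q, hq, rfl⟩ := Finset.mem_image.mp hp
      exact hshare ⟨q, D q, _, hD q hq, hD _ hpL⟩
    have hcard : 2 * L.card ≤ n := by
      have := Finset.card_le_univ (L ∪ L.image fun q => q + (D q : ZMod n))
      rw [Finset.card_union_of_disjoint hdisj, hRcard, ZMod.card] at this
      omega
    refine ⟨L.image fun q => q + 1, Finset.card_image_le.trans (by omega), fun q d hq => ?_⟩
    have hd2 := hq.1.1
    exact ⟨1, by omega, by omega, Finset.mem_image.mpr ⟨q, (hL q).mpr ⟨d, hq⟩, by simp⟩⟩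

section Wheel

variable {n : ℕ} [NeZero n]

/-- The rim vertex at a position modulo `n`. -/
def rim (x : ZMod n) : Option (Fin n) := some ((ZMod.finEquiv n).symm x)

/-- The rim edge joining positions `x` and `x + 1`. -/
def rimEdge (x : ZMod n) : Sym2 (Option (Fin n)) := s(rim x, rim (x + 1))

/-- The spoke at position `x`. -/
def spoke (x : ZMod n) : Sym2 (Option (Fin n)) := s(none, rim x)

lemma rim_injective : Function.Injective (rim : ZMod n → Option (Fin n)) :=
  (Option.some_injective _).comp (ZMod.finEquiv n).symm.injective

@[simp] lemma rim_inj {x y : ZMod n} : rim x = rim y ↔ x = y := rim_injective.eq_iff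

@[simp] lemma rim_ne_none (x : ZMod n) : rim x ≠ none := Option.some_ne_none _

@[simp] lemma none_ne_rim (x : ZMod n) : none ≠ rim x := (Option.some_ne_none _).symm

lemma eq_rim_of_ne_none {v : Option (Fin n)} (h : v ≠ none) : ∃ x, v = rim x := by
  obtain ⟨a, rfl⟩ := Option.ne_none_iff_exists'.mp h
  exact ⟨ZMod.finEquiv n a, by simp [rim]⟩

lemma adj_none_rim (x : ZMod n) : (wheelGraph n).Adj none (rim x) := by
  simp [wheelGraph, SimpleGraph.fromRel_adj]

lemma adj_rim (hn : 3 ≤ n) {x y : ZMod n} :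
    (wheelGraph n).Adj (rim x) (rim y) ↔ y - x = 1 ∨ y - x = -1 := by
  obtain ⟨m, rfl⟩ := Nat.exists_eq_add_of_le' hn
  have : Fact (1 < m + 3) := ⟨by omega⟩
  have key : ∀ a b : ZMod (m + 3),
      (cycleGraph (m + 3)).Adj ((ZMod.finEquiv (m + 3)).symm a) ((ZMod.finEquiv (m + 3)).symm b) ↔
        a - b = 1 ∨ b - a = 1 := fun a b => Iff.rfl
  have h2 : ∀ a b : ZMod (m + 3), a - b = 1 ↔ b - a = -1 := fun a b => by
    rw [← neg_inj, neg_sub]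
  have hne : (y - x = 1 ∨ y - x = -1) → x ≠ y := by
    rintro h rfl
    simp at h
  simp only [wheelGraph, SimpleGraph.fromRel_adj, rim_ne_none, false_or]
  simp only [rim, Option.some.injEq, ne_eq]
  constructor
  · rintro ⟨-, ⟨a, b, rfl, rfl, h⟩ | ⟨a, b, rfl, rfl, h⟩⟩ <;> rw [key, h2] at h
    · exact h.symm
    · rw [← h2] at h
      exact h.imp id (h2 _ _).mp
  · intro h
    refine ⟨?_, Or.inl ⟨_, _, rfl, rfl, ?_⟩⟩
    · simpa using hne h
    · rw [key, h2]
      exact h.symm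

lemma adj_rim_succ (hn : 3 ≤ n) (x : ZMod n) : (wheelGraph n).Adj (rim x) (rim (x + 1)) :=
  (adj_rim hn).mpr (by simp)

lemma spoke_injective : Function.Injective (spoke : ZMod n → Sym2 (Option (Fin n))) := by
  intro x y h
  simpa [spoke] using h

lemma spoke_ne_rimEdge (x y : ZMod n) : spoke x ≠ rimEdge y := by
  simp [spoke, rimEdge]

lemma rimEdge_injective (hn : 3 ≤ n) :
    Function.Injective (rimEdge : ZMod n → Sym2 (Option (Fin n))) := by
  intro x y h
  simp only [rimEdge, Sym2.eq_iff, rim_inj] at h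
  obtain h | ⟨rfl, h⟩ := h
  · exact h.1
  · have h' : y + ((2 : ℕ) : ZMod n) = y + (0 : ℕ) := by
      push_cast
      linear_combination h
    have := eq_of_add_natCast_eq h' (by omega) (by omega)
    omega

/-- The walk along the rim from position `x` to position `x + m`. -/
def rimWalk (hn : 3 ≤ n) : (m : ℕ) → (x : ZMod n) → (wheelGraph n).Walk (rim x) (rim (x + (m : ZMod n)))
  | 0, x => Walk.nil.copy rfl (by simp)
  | m + 1, x => (Walk.cons (adj_rim_succ hn x) (rimWalk hn m (x + 1))).copy rfl
      (by push_cast; congr 1; ring)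

lemma support_rimWalk (hn : 3 ≤ n) (m : ℕ) (x : ZMod n) :
    (rimWalk hn m x).support = (List.range (m + 1)).map fun t : ℕ => rim (x + (t : ZMod n)) := by
  induction m generalizing x with
  | zero => simp [rimWalk]
  | succ m ih =>
    rw [rimWalk, Walk.support_copy, Walk.support_cons, ih, List.range_succ_eq_map (n := m + 1)]
    simp [add_comm, add_left_comm]

lemma edges_rimWalk (hn : 3 ≤ n) (m : ℕ) (x : ZMod n) :
    (rimWalk hn m x).edges = (List.range m).map fun t : ℕ => rimEdge (x + (t : ZMod n)) := by
  induction m generalizing x with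
  | zero => simp [rimWalk]
  | succ m ih =>
    rw [rimWalk, Walk.edges_copy, Walk.edges_cons, ih, List.range_succ_eq_map (n := m)]
    simp [rimEdge, add_assoc, add_comm, add_left_comm]

lemma isPath_rimWalk (hn : 3 ≤ n) {m : ℕ} (hm : m < n) (x : ZMod n) :
    (rimWalk hn m x).IsPath := by
  rw [Walk.isPath_def, support_rimWalk]
  refine List.Nodup.map_on (fun a ha b hb h => ?_) List.nodup_range
  rw [List.mem_range] at ha hb
  exact eq_of_add_natCast_eq (rim_injective h) (by omega) (by omega)

/-- The rim is a cycle. -/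
lemma exists_rim_cycle (hn : 3 ≤ n) :
    ∃ (u : Option (Fin n)) (c : (wheelGraph n).Walk u u), c.IsCycle ∧
      (∀ x, rim x ∈ c.support) ∧ (∀ e ∈ c.edges, ∃ x, e = rimEdge x) := by
  obtain ⟨m, rfl⟩ := Nat.exists_eq_add_of_le' (show 1 ≤ n by omega)
  have hlast : (0 : ZMod (m + 1)) + m + 1 = 0 := by
    have := ZMod.natCast_self (m + 1)
    push_cast at this
    linear_combination this
  have hadj := adj_rim_succ hn ((0 : ZMod (m + 1)) + m)
  have hedge : s(rim ((0 : ZMod (m + 1)) + (m : ZMod (m + 1))), rim 0) = rimEdge ((0 : ZMod (m + 1)) + (m : ZMod (m + 1))) := by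
    rw [rimEdge, hlast]
  rw [hlast] at hadj
  refine ⟨_, Walk.cons hadj (rimWalk hn m 0), ?_, ?_, ?_⟩
  · rw [Walk.cons_isCycle_iff, hedge, edges_rimWalk]
    refine ⟨isPath_rimWalk hn (by omega) _, fun h => ?_⟩
    obtain ⟨t, ht, h⟩ := List.mem_map.mp h
    rw [List.mem_range] at ht
    have := eq_of_add_natCast_eq (rimEdge_injective hn h) (by omega) (by omega)
    omega
  · intro x
    obtain ⟨t, ht, rfl⟩ := exists_eq_add_natCast 0 x
    rw [Walk.support_cons, support_rimWalk]
    exact List.mem_cons_of_mem _ (List.mem_map.mpr ⟨t, List.mem_range.mpr ht, rfl⟩)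
  · intro e he
    rw [Walk.edges_cons, hedge, edges_rimWalk] at he
    rcases List.mem_cons.mp he with rfl | he
    · exact ⟨_, rfl⟩
    · obtain ⟨t, -, rfl⟩ := List.mem_map.mp he
      exact ⟨_, rfl⟩

/-- The centre together with `m + 1` consecutive rim vertices carries a cycle. -/
lemma exists_fan_cycle (hn : 3 ≤ n) {m : ℕ} (hm : 1 ≤ m) (hmn : m < n) (x : ZMod n) :
    ∃ c : (wheelGraph n).Walk none none, c.IsCycle ∧
      (∀ t ≤ m, rim (x + (t : ZMod n)) ∈ c.support) ∧
      c.edges = spoke x :: ((List.range m).map fun t : ℕ => rimEdge (x + (t : ZMod n))) ++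
        [spoke (x + (m : ZMod n))] := by
  have hs : s(rim (x + (m : ZMod n)), none) = spoke (x + (m : ZMod n)) := Sym2.eq_swap
  refine ⟨Walk.cons (adj_none_rim x) ((rimWalk hn m x).concat (adj_none_rim _).symm), ?_, ?_, ?_⟩
  · rw [Walk.cons_isCycle_iff, Walk.concat_isPath_iff, Walk.edges_concat, edges_rimWalk,
      support_rimWalk, hs]
    refine ⟨⟨isPath_rimWalk hn hmn x, by simp⟩, fun h => ?_⟩
    rw [List.concat_eq_append, List.mem_append, List.mem_singleton] at h
    rcases h with h | h
    · obtain ⟨t, -, h⟩ := List.mem_map.mp h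
      exact spoke_ne_rimEdge _ _ h.symm
    · have h : x + ((0 : ℕ) : ZMod n) = x + (m : ℕ) := by
        simpa using spoke_injective h
      have := eq_of_add_natCast_eq h (by omega) hmn
      omega
  · intro t ht
    rw [Walk.support_cons, Walk.support_concat, support_rimWalk]
    simp only [List.mem_cons, List.mem_append, List.mem_map, List.mem_range]
    exact Or.inr (Or.inl ⟨t, by omega, rfl⟩)
  · rw [Walk.edges_cons, Walk.edges_concat, edges_rimWalk, hs]
    simp [spoke]

lemma rimEdge_mem_edges_of_none_notMem (hn : 3 ≤ n) {u : Option (Fin n)}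
    {c : (wheelGraph n).Walk u u} (hc : c.IsCycle) (h : none ∉ c.support) (y : ZMod n) :
    rimEdge y ∈ c.edges := by
  have hex : ∀ i, ∃ z, c.getVert i = rim z := fun i =>
    eq_rim_of_ne_none fun h0 => h (h0 ▸ c.getVert_mem_support i)
  choose x hx using hex
  have h3 := hc.three_le_length
  obtain ⟨ε, hε, hdir⟩ := exists_direction (x := x) (l := c.length + 1)
    (fun i hi => by
      have := c.adj_getVert_succ (i := i) (by omega)
      rwa [hx, hx, adj_rim hn] at this)
    (fun i hi => by
      have := hc.getVert_sub_one_ne_getVert_add_one (i := i + 1) (by omega)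
      simpa [hx] using this)
  have hclosed : x c.length = x 0 := by
    rw [← rim_inj, ← hx, ← hx]
    simp
  have hlen : n ≤ c.length := by
    have h0 := hdir c.length (by omega)
    rw [hclosed, left_eq_add] at h0
    have h0 : (c.length : ZMod n) = 0 := by
      rcases hε with rfl | rfl <;> simpa using h0
    exact Nat.le_of_dvd (by omega) ((ZMod.natCast_eq_zero_iff _ _).mp h0)
  rw [rimEdge, Walk.mk_mem_edges_iff_exists]
  rcases hε with rfl | rfl
  · obtain ⟨t, ht, rfl⟩ := exists_eq_add_natCast (x 0) y
    refine ⟨t, by omega, ?_⟩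
    rw [hx, hx, hdir t (by omega), hdir (t + 1) (by omega)]
    push_cast
    ring_nf
  · obtain ⟨t, ht, h0⟩ := exists_eq_add_natCast (y + 1) (x 0)
    refine ⟨t, by omega, ?_⟩
    rw [hx, hx, hdir t (by omega), hdir (t + 1) (by omega), h0, Sym2.eq_swap]
    push_cast
    ring_nf

/-- A cycle through the centre traverses a run of consecutive rim vertices. -/
lemma exists_run_of_none_mem (hn : 3 ≤ n) {u : Option (Fin n)}
    {c : (wheelGraph n).Walk u u} (hc : c.IsCycle) (h : none ∈ c.support) :
    ∃ (p : ZMod n) (m : ℕ), 1 ≤ m ∧ m + 2 = c.length ∧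
      (∀ y, rim y ∈ c.support → ∃ t ≤ m, y = p + (t : ZMod n)) ∧
      (∀ t < m, rimEdge (p + (t : ZMod n)) ∈ c.edges) ∧
      spoke p ∈ c.edges ∧ spoke (p + (m : ZMod n)) ∈ c.edges := by
  have key : ∀ (d : (wheelGraph n).Walk none none) (p : ZMod n) (m : ℕ), 1 ≤ m →
      m + 2 = d.length → (∀ t ≤ m, d.getVert (t + 1) = rim (p + (t : ZMod n))) →
      (∀ y, rim y ∈ d.support → ∃ t ≤ m, y = p + (t : ZMod n)) ∧
      (∀ t < m, rimEdge (p + (t : ZMod n)) ∈ d.edges) ∧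
      spoke p ∈ d.edges ∧ spoke (p + (m : ZMod n)) ∈ d.edges := by
    intro d p m hm hlen hd
    refine ⟨fun y hy => ?_, fun t ht => ?_, ?_, ?_⟩
    · obtain ⟨i, hi, hil⟩ := Walk.mem_support_iff_exists_getVert.mp hy
      have hi0 : i ≠ 0 := by
        rintro rfl
        simp at hi
      have hil' : i ≠ d.length := by
        rintro rfl
        simp at hi
      have := hd (i - 1) (by omega)
      rw [Nat.sub_add_cancel (by omega), hi, rim_inj] at this
      exact ⟨i - 1, by omega, this⟩
    · rw [rimEdge, Walk.mk_mem_edges_iff_exists]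
      refine ⟨t + 1, by omega, ?_⟩
      rw [hd t ht.le, hd (t + 1) ht]
      push_cast
      ring_nf
    · rw [spoke, Walk.mk_mem_edges_iff_exists]
      refine ⟨0, by omega, ?_⟩
      rw [hd 0 (by omega)]
      simp
    · rw [spoke, Walk.mk_mem_edges_iff_exists]
      refine ⟨m + 1, by omega, ?_⟩
      rw [hd m le_rfl, show m + 1 + 1 = d.length by omega, Walk.getVert_length, Sym2.eq_swap]
  obtain ⟨d, hd, hlen, hsupp, hedges⟩ : ∃ d : (wheelGraph n).Walk none none, d.IsCycle ∧
      d.length = c.length ∧ (∀ v, v ∈ d.support ↔ v ∈ c.support) ∧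
      (∀ e, e ∈ d.edges ↔ e ∈ c.edges) :=
    ⟨c.rotate none h, hc.rotate h, c.length_rotate none h,
      fun v => c.mem_support_rotate_iff none h, fun e => (c.rotate_edges none h).mem_iff⟩
  simp only [← hlen, ← hsupp, ← hedges]
  have h3 := hd.three_le_length
  have hex : ∀ i, ∃ z, i + 1 < d.length → d.getVert (i + 1) = rim z := by
    intro i
    by_cases hi : i + 1 < d.length
    · obtain ⟨z, hz⟩ := eq_rim_of_ne_none fun h0 : d.getVert (i + 1) = none => by
        rcases (hd.getVert_endpoint_iff hi.le).mp h0 with h0 | h0 <;> omega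
      exact ⟨z, fun _ => hz⟩
    · exact ⟨0, fun h0 => (hi h0).elim⟩
  choose x hx using hex
  obtain ⟨ε, hε, hdir⟩ := exists_direction (x := x) (l := d.length - 1)
    (fun i hi => by
      have := d.adj_getVert_succ (i := i + 1) (by omega)
      rwa [hx i (by omega), hx (i + 1) (by omega), adj_rim hn] at this)
    (fun i hi => by
      have := hd.getVert_sub_one_ne_getVert_add_one (i := i + 2) (by omega)
      simpa [hx i (by omega), hx (i + 2) (by omega)] using this)
  obtain ⟨m, hm⟩ : ∃ m, m + 2 = d.length := ⟨d.length - 2, by omega⟩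
  rcases hε with rfl | rfl
  · refine ⟨x 0, m, by omega, hm, key d _ _ (by omega) hm fun t ht => ?_⟩
    rw [hx t (by omega), hdir t (by omega), mul_one]
  · refine ⟨x m, m, by omega, hm, ?_⟩
    have := key d.reverse (x m) m (by omega) (by simpa using hm) fun t ht => by
      have hsub : d.length - (t + 1) = (m - t) + 1 := by omega
      rw [Walk.getVert_reverse, hsub, hx (m - t) (by omega), hdir m (by omega),
        hdir (m - t) (by omega), Nat.cast_sub ht]
      ring_nf
    simpa using this

/-- With at most `n` colours, a rainbow cycle of the wheel is either the rim, or it passes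
through the centre and misses at least one rim vertex. -/
lemma rainbow_cycle_cases (hn : 3 ≤ n) {φ : Sym2 (Option (Fin n)) → ℕ} {r : ℕ} (hr : r ≤ n)
    (hφ : ∀ e ∈ (wheelGraph n).edgeSet, φ e < r) {u : Option (Fin n)}
    {c : (wheelGraph n).Walk u u} (hc : c.IsCycle) (hrain : (c.edges.map φ).Nodup) :
    (none ∉ c.support ∧ Function.Injective fun x : ZMod n => φ (rimEdge x)) ∨
    ∃ (p : ZMod n) (m : ℕ), m + 2 ≤ n ∧
      (∀ y, rim y ∈ c.support → ∃ t ≤ m, y = p + (t : ZMod n)) ∧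
      (∀ s < m, ∀ t < m, φ (rimEdge (p + (s : ZMod n))) = φ (rimEdge (p + (t : ZMod n))) →
        p + (s : ZMod n) = p + (t : ZMod n)) ∧
      (∀ t < m, φ (spoke p) ≠ φ (rimEdge (p + (t : ZMod n)))) ∧
      (∀ t < m, φ (spoke (p + (m : ZMod n))) ≠ φ (rimEdge (p + (t : ZMod n)))) := by
  have hinj : ∀ e ∈ c.edges, ∀ f ∈ c.edges, φ e = φ f → e = f := fun e he f hf hef =>
    List.inj_on_of_nodup_map hrain he hf hef
  by_cases h : none ∈ c.support
  · right
    obtain ⟨p, m, -, hlen, hsupp, hrim, hp, hq⟩ := exists_run_of_none_mem hn hc h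
    have hle : c.length ≤ r := by
      have hsub : (c.edges.map φ).toFinset ⊆ Finset.range r := by
        intro a ha
        obtain ⟨e, he, rfl⟩ := List.mem_map.mp (List.mem_toFinset.mp ha)
        exact Finset.mem_range.mpr (hφ e (c.edges_subset_edgeSet he))
      have := Finset.card_le_card hsub
      rwa [List.toFinset_card_of_nodup hrain, List.length_map, Walk.length_edges,
        Finset.card_range] at this
    refine ⟨p, m, by omega, hsupp, fun s hs t ht hst => ?_, fun t ht hst => ?_, fun t ht hst => ?_⟩
    · exact rimEdge_injective hn (hinj _ (hrim s hs) _ (hrim t ht) hst)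
    · exact spoke_ne_rimEdge _ _ (hinj _ hp _ (hrim t ht) hst)
    · exact spoke_ne_rimEdge _ _ (hinj _ hq _ (hrim t ht) hst)
  · exact Or.inl ⟨h, fun x y hxy => rimEdge_injective hn <|
      hinj _ (rimEdge_mem_edges_of_none_notMem hn hc h x) _
        (rimEdge_mem_edges_of_none_notMem hn hc h y) hxy⟩

/-- With at most `n` colours, the rim is rainbow. -/
lemma injective_rimEdge_color (hn : 3 ≤ n) {φ : Sym2 (Option (Fin n)) → ℕ} {r k : ℕ}
    (hk : 4 ≤ k) (hkn : k ≤ n + 1) (hr : r ≤ n) (hφ : ∀ e ∈ (wheelGraph n).edgeSet, φ e < r)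
    (h : (wheelGraph n).IsRainbowCycleColoring k φ) :
    Function.Injective fun x : ZMod n => φ (rimEdge x) := by
  classical
  intro i j hij
  obtain ⟨S, hsub, -, hcard⟩ := Finset.exists_subsuperset_card_eq
    (s := ({rim i, rim (i + 1), rim j, rim (j + 1)} : Finset (Option (Fin n))))
    (Finset.subset_univ _) (Finset.card_le_four.trans hk) (n := k) (by simpa using hkn)
  obtain ⟨u, c, hc, hS, hrain⟩ := h S hcard
  rcases rainbow_cycle_cases hn hr hφ hc hrain with ⟨-, hinj⟩ | ⟨p, m, hm, hsupp, hrim, -, -⟩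
  · exact hinj hij
  · have hoffset : ∀ x, rim x ∈ S → rim (x + 1) ∈ S → ∃ t < m, x = p + (t : ZMod n) := by
      intro x hx hx'
      obtain ⟨t, ht, rfl⟩ := hsupp _ (hS _ hx)
      obtain ⟨t', ht', heq⟩ := hsupp _ (hS _ hx')
      have heq : p + ((t + 1 : ℕ) : ZMod n) = p + (t' : ZMod n) := by
        rw [← heq]
        push_cast
        ring
      have := eq_of_add_natCast_eq heq (by omega) (by omega)
      exact ⟨t, by omega, rfl⟩
    obtain ⟨s, hs, rfl⟩ := hoffset i (hsub (by simp)) (hsub (by simp))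
    obtain ⟨t, ht, rfl⟩ := hoffset j (hsub (by simp)) (hsub (by simp))
    exact hrim s hs t ht hij

lemma rimEdge_mem_edgeSet (hn : 3 ≤ n) (x : ZMod n) : rimEdge x ∈ (wheelGraph n).edgeSet :=
  adj_rim_succ hn x

lemma spoke_mem_edgeSet (x : ZMod n) : spoke x ∈ (wheelGraph n).edgeSet :=
  adj_none_rim x

/-- At least `n` colours are needed. -/
lemma le_of_isRainbowCycleColoring (hn : 3 ≤ n) {φ : Sym2 (Option (Fin n)) → ℕ} {r k : ℕ}
    (hk : 4 ≤ k) (hkn : k ≤ n + 1) (hφ : ∀ e ∈ (wheelGraph n).edgeSet, φ e < r)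
    (h : (wheelGraph n).IsRainbowCycleColoring k φ) : n ≤ r := by
  by_contra! hr
  have := Finset.card_le_card_of_injOn (s := Finset.univ) (t := Finset.range r)
    (fun x : ZMod n => φ (rimEdge x))
    (fun x _ => Finset.mem_coe.mpr (Finset.mem_range.mpr (hφ _ (rimEdge_mem_edgeSet hn x))))
    (injective_rimEdge_color hn hk hkn hr.le hφ h).injOn
  rw [Finset.card_univ, ZMod.card, Finset.card_range] at this
  omega

/-- If `n < 2 * k`, then `n` colours do not suffice. -/
lemma lt_of_isRainbowCycleColoring (hn : 3 ≤ n) {φ : Sym2 (Option (Fin n)) → ℕ} {r k : ℕ}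
    (hk : 4 ≤ k) (hkn : k ≤ n + 1) (hnk : n < 2 * k)
    (hφ : ∀ e ∈ (wheelGraph n).edgeSet, φ e < r)
    (h : (wheelGraph n).IsRainbowCycleColoring k φ) : n < r := by
  classical
  by_contra! hr
  have hinj := injective_rimEdge_color hn hk hkn hr hφ h
  have hex : ∀ x : ZMod n, ∃ y : ZMod n, φ (rimEdge y) = φ (spoke x) := by
    intro x
    have himage : Finset.univ.image (fun y : ZMod n => φ (rimEdge y)) = Finset.range r := by
      refine Finset.eq_of_subset_of_card_le ?_ ?_
      · intro a ha
        obtain ⟨y, -, rfl⟩ := Finset.mem_image.mp ha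
        exact Finset.mem_range.mpr (hφ _ (rimEdge_mem_edgeSet hn y))
      · rwa [Finset.card_image_of_injective _ hinj, Finset.card_univ, ZMod.card,
          Finset.card_range]
    have := Finset.mem_range.mpr (hφ _ (spoke_mem_edgeSet x))
    rw [← himage, Finset.mem_image] at this
    obtain ⟨y, -, hy⟩ := this
    exact ⟨y, hy⟩
  choose f hf using hex
  obtain ⟨T, hT, hit⟩ := exists_hitting_set f (l := k - 1) (by omega) (by omega)
  obtain ⟨S, hTS, -, hcard⟩ := Finset.exists_subsuperset_card_eq
    (Finset.subset_univ T) hT (by rw [Finset.card_univ, ZMod.card]; omega)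
  obtain ⟨u, c, hc, hsupp, hrain⟩ := h (insert none (S.image rim)) (by
    rw [Finset.card_insert_of_notMem (by simp), Finset.card_image_of_injective _ rim_injective]
    omega)
  rcases rainbow_cycle_cases hn hr hφ hc hrain with ⟨h0, -⟩ | ⟨p, m, hm, hrun, -, hp, hq⟩
  · exact h0 (hsupp _ (Finset.mem_insert_self _ _))
  obtain ⟨d, hd⟩ : ∃ d, m + d = n := ⟨n - m, by omega⟩
  have hcast : (m : ZMod n) + (d : ZMod n) = 0 := by
    rw [← Nat.cast_add, hd, ZMod.natCast_self]
  have hinside : ∀ x, (∀ t < m, φ (spoke x) ≠ φ (rimEdge (p + (t : ZMod n)))) →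
      ∃ i < d, f x = p + (m : ZMod n) + (i : ZMod n) := by
    intro x hx
    obtain ⟨t, ht, hft⟩ := exists_eq_add_natCast p (f x)
    have htm : m ≤ t := by
      by_contra! htm
      exact hx t htm (by rw [← hft, hf])
    refine ⟨t - m, by omega, ?_⟩
    rw [hft, add_assoc, ← Nat.cast_add, show m + (t - m) = t by omega]
  obtain ⟨t, ht0, htd, ht⟩ := hit (p + (m : ZMod n)) d ⟨by omega, hinside _ hq, by
    rw [add_assoc, hcast, add_zero]
    exact hinside _ hp⟩
  obtain ⟨s, hs, heq⟩ := hrun _ (hsupp _ (Finset.mem_insert_of_mem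
    (Finset.mem_image_of_mem rim (hTS ht))))
  rw [add_assoc, ← Nat.cast_add] at heq
  have := eq_of_add_natCast_eq heq (by omega) (by omega)
  omega

/-- A colouring of the wheel with prescribed colours on the rim edges and on the spokes. -/
lemma exists_coloring (hn : 3 ≤ n) {r : ℕ} (a b : ZMod n → ℕ) (ha : ∀ x, a x < r)
    (hb : ∀ x, b x < r) :
    ∃ φ : Sym2 (Option (Fin n)) → ℕ, (∀ e, φ e < r) ∧ (∀ x, φ (rimEdge x) = a x) ∧
      ∀ x, φ (spoke x) = b x := by
  classical
  refine ⟨Function.extend rimEdge a (Function.extend spoke b 0), fun e => ?_,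
    (rimEdge_injective hn).extend_apply _ _, fun x => ?_⟩
  · by_cases he : ∃ x, rimEdge x = e
    · obtain ⟨x, rfl⟩ := he
      rw [(rimEdge_injective hn).extend_apply]
      exact ha x
    · rw [Function.extend_apply' _ _ _ he]
      by_cases he' : ∃ x, spoke x = e
      · obtain ⟨x, rfl⟩ := he'
        rw [spoke_injective.extend_apply]
        exact hb x
      · rw [Function.extend_apply' _ _ _ he']
        exact (Nat.zero_le _).trans_lt (ha 0)
  · rw [Function.extend_apply', spoke_injective.extend_apply]
    rintro ⟨y, hy⟩
    exact spoke_ne_rimEdge _ _ hy.symm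

/-- If spokes at both ends of a run avoid the colours of the run, the fan cycle is rainbow. -/
lemma exists_rainbow_fan (hn : 3 ≤ n) {φ : Sym2 (Option (Fin n)) → ℕ} {m : ℕ} (hm : 1 ≤ m)
    (hmn : m < n) (p : ZMod n) {a : ℕ} {b : ℕ}
    (ha : φ (spoke p) = a) (hb : φ (spoke (p + (m : ZMod n))) = b) (hab : a ≠ b)
    (hrim : Set.InjOn (fun t : ℕ => φ (rimEdge (p + (t : ZMod n)))) {t | t < m})
    (hal : ∀ t < m, φ (rimEdge (p + (t : ZMod n))) ≠ a)
    (hbl : ∀ t < m, φ (rimEdge (p + (t : ZMod n))) ≠ b) {S : Finset (Option (Fin n))}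
    (hS : ∀ y, rim y ∈ S → ∃ t ≤ m, y = p + (t : ZMod n)) :
    ∃ (u : Option (Fin n)) (c : (wheelGraph n).Walk u u), c.IsCycle ∧ (∀ v ∈ S, v ∈ c.support) ∧
      (c.edges.map φ).Nodup := by
  obtain ⟨c, hc, hsupp, hedges⟩ := exists_fan_cycle hn hm hmn p
  refine ⟨_, c, hc, fun v hv => ?_, ?_⟩
  · by_cases h0 : v = none
    · exact h0 ▸ c.start_mem_support
    · obtain ⟨y, rfl⟩ := eq_rim_of_ne_none h0
      obtain ⟨t, ht, rfl⟩ := hS y hv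
      exact hsupp t ht
  · rw [hedges]
    simp only [List.cons_append, List.map_cons, List.map_append, List.map_map, List.map_nil,
      List.nodup_cons, ha, hb]
    refine ⟨?_, List.Nodup.append (List.Nodup.map_on ?_ List.nodup_range)
      (List.nodup_singleton _) ?_⟩
    · simp only [List.mem_append, List.mem_map, List.mem_range, List.mem_singleton, not_or]
      refine ⟨?_, hab⟩
      rintro ⟨t, ht, h⟩
      exact hal t ht h
    · intro s hs t ht h
      exact hrim (List.mem_range.mp hs) (List.mem_range.mp ht) h
    · simp only [List.disjoint_singleton, List.mem_map, List.mem_range]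
      rintro ⟨t, ht, h⟩
      exact hbl t ht h

/-- A rainbow Hamiltonian cycle uses `n + 1` colours. -/
lemma exists_coloring_succ (hn : 3 ≤ n) (k : ℕ) :
    ∃ φ : Sym2 (Option (Fin n)) → ℕ, (∀ e ∈ (wheelGraph n).edgeSet, φ e < n + 1) ∧
      (wheelGraph n).IsRainbowCycleColoring k φ := by
  have hval : ∀ t < n, (0 + (t : ZMod n)).val = t := fun t ht => by
    rw [zero_add, ZMod.val_natCast, Nat.mod_eq_of_lt ht]
  obtain ⟨φ, hφ, hrim, hspoke⟩ := exists_coloring hn (r := n + 1) (fun x : ZMod n => x.val)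
    (fun x => if x = 0 then n else n - 1) (fun x => (ZMod.val_lt x).trans (by omega))
    (fun x => by split_ifs <;> omega)
  refine ⟨φ, fun e _ => hφ e, fun S _ => ?_⟩
  refine exists_rainbow_fan hn (m := n - 1) (by omega) (by omega) 0 (a := n) (b := n - 1)
    (by simp [hspoke]) ?_ (by omega) ?_ ?_ ?_ fun y _ => ?_
  · rw [hspoke, if_neg]
    intro h
    have := hval (n - 1) (by omega)
    rw [h, ZMod.val_zero] at this
    omega
  · intro s hs t ht h
    simp only [Set.mem_ofPred_eq] at hs ht
    simp only [hrim] at h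
    rwa [hval s (by omega), hval t (by omega)] at h
  · intro t ht
    rw [hrim, hval t (by omega)]
    omega
  · intro t ht
    rw [hrim, hval t (by omega)]
    omega
  · obtain ⟨t, ht, h⟩ := exists_eq_add_natCast 0 y
    exact ⟨t, by omega, h⟩

/-- If `2 * k ≤ n`, then `n` colours suffice. -/
lemma exists_coloring_of_two_mul_le {k : ℕ} (hk : 4 ≤ k) (hnk : 2 * k ≤ n) :
    ∃ φ : Sym2 (Option (Fin n)) → ℕ, (∀ e ∈ (wheelGraph n).edgeSet, φ e < n) ∧
      (wheelGraph n).IsRainbowCycleColoring k φ := by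
  classical
  have hn : 3 ≤ n := by omega
  obtain ⟨φ, hφ, hrim, hspoke⟩ := exists_coloring hn (r := n) (fun x : ZMod n => x.val)
    (fun x => if x.val % 2 = 1 ∨ x.val = n - 1 then x.val else (x - 1).val)
    ZMod.val_lt (fun x => by split_ifs <;> exact ZMod.val_lt _)
  refine ⟨φ, fun e _ => hφ e, fun S hS => ?_⟩
  by_cases h0 : none ∈ S
  swap
  · obtain ⟨u, c, hc, hsupp, hedges⟩ := exists_rim_cycle hn
    refine ⟨u, c, hc, fun v hv => ?_, List.Nodup.map_on (fun e he f hf hef => ?_) hc.edges_nodup⟩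
    · obtain ⟨y, rfl⟩ := eq_rim_of_ne_none fun h : v = none => h0 (h ▸ hv)
      exact hsupp y
    · obtain ⟨x, rfl⟩ := hedges e he
      obtain ⟨y, rfl⟩ := hedges f hf
      rw [hrim, hrim] at hef
      rw [ZMod.val_injective n hef]
  have fan : ∀ P m Q : ℕ, P + 1 < n → P % 2 = 0 → Q < n → (Q % 2 = 1 ∨ Q = n - 1) →
      (P + m = Q ∨ P + m = Q + n) → 1 ≤ m → m + 2 ≤ n →
      (∀ x : ZMod n, rim x ∈ S → (P ≤ x.val ∧ x.val ≤ P + m) ∨ x.val + n ≤ P + m) →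
      ∃ (u : Option (Fin n)) (c : (wheelGraph n).Walk u u), c.IsCycle ∧
        (∀ v ∈ S, v ∈ c.support) ∧ (c.edges.map φ).Nodup := by
    intro P m Q hPn hP hQn hQ hPQ hm hmn hin
    have hinj : ∀ s < n, ∀ t < n,
        ((P : ZMod n) + (s : ZMod n)).val = ((P : ZMod n) + (t : ZMod n)).val → s = t :=
      fun s hs t ht h => eq_of_add_natCast_eq (ZMod.val_injective n h) hs ht
    have hend : ((P : ZMod n) + (m : ZMod n)).val = Q := by
      rw [← Nat.cast_add, ZMod.val_natCast]
      rcases hPQ with h | h <;> rw [h]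
      · exact Nat.mod_eq_of_lt hQn
      · rw [Nat.add_mod_right, Nat.mod_eq_of_lt hQn]
    have hstart : (P : ZMod n).val = P := by
      rw [ZMod.val_natCast, Nat.mod_eq_of_lt (by omega)]
    refine exists_rainbow_fan hn (m := m) hm (by omega) (P : ZMod n)
      (a := ((P : ZMod n) + ((n - 1 : ℕ) : ZMod n)).val)
      (b := ((P : ZMod n) + (m : ZMod n)).val) ?_ ?_ ?_ ?_ ?_ ?_ ?_
    · rw [hspoke, hstart, if_neg (by omega), Nat.cast_sub (by omega), ZMod.natCast_self]
      push_cast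
      ring_nf
    · rw [hspoke, hend, if_pos hQ]
    · intro h
      have := hinj _ (by omega) _ (by omega) h
      omega
    · intro s hs t ht h
      simp only [Set.mem_ofPred_eq] at hs ht
      simp only [hrim] at h
      exact hinj s (by omega) t (by omega) h
    · intro t ht h
      rw [hrim] at h
      have := hinj _ (by omega) _ (by omega) h
      omega
    · intro t ht h
      rw [hrim] at h
      have := hinj _ (by omega) _ (by omega) h
      omega
    · intro x hx
      have hlt := x.val_lt
      rcases hin x hx with ⟨h1, h2⟩ | h
      · refine ⟨x.val - P, by omega, ?_⟩
        rw [← Nat.cast_add, Nat.add_sub_cancel' h1, ZMod.natCast_zmod_val]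
      · refine ⟨x.val + n - P, by omega, ?_⟩
        rw [← Nat.cast_add, Nat.add_sub_cancel' (by omega), Nat.cast_add, ZMod.natCast_self,
          ZMod.natCast_zmod_val, add_zero]
  obtain ⟨i, hik, hi⟩ : ∃ i < k, ∀ x : ZMod n, rim x ∈ S → min (x.val / 2) (k - 1) ≠ i := by
    by_contra! hcover
    let T : Finset (ZMod n) := Finset.univ.filter fun x => rim x ∈ S
    have hT : T.card < k := by
      rw [← hS, ← Finset.card_image_of_injective T rim_injective]
      refine Finset.card_lt_card ((Finset.ssubset_iff_of_subset ?_).mpr ⟨none, h0, by simp⟩)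
      intro v hv
      obtain ⟨x, hx, rfl⟩ := Finset.mem_image.mp hv
      exact (Finset.mem_filter.mp hx).2
    have hsub : Finset.range k ⊆ T.image fun x => min (x.val / 2) (k - 1) := by
      intro i hi
      obtain ⟨x, hx, hxi⟩ := hcover i (Finset.mem_range.mp hi)
      exact Finset.mem_image.mpr ⟨x, by simpa [T] using hx, hxi⟩
    have := (Finset.card_le_card hsub).trans Finset.card_image_le
    rw [Finset.card_range] at this
    omega
  rcases Nat.eq_zero_or_pos i with rfl | hi0
  · refine fan 2 (n - 3) (n - 1) (by omega) (by omega) (by omega) (by omega) (by omega) (by omega)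
      (by omega) fun x hx => ?_
    have := hi x hx
    have := x.val_lt
    omega
  · by_cases hlast : i = k - 1
    · refine fan 0 (2 * k - 3) (2 * k - 3) (by omega) (by omega) (by omega) (by omega) (by omega)
        (by omega) (by omega) fun x hx => ?_
      have := hi x hx
      omega
    · refine fan (2 * i + 2) (n - 3) (2 * i - 1) (by omega) (by omega) (by omega) (by omega)
        (by omega) (by omega) (by omega) fun x hx => ?_
      have := hi x hx
      have := x.val_lt
      omega

end Wheel

end wheelGraph

/-- for k ≥ 4, crx_k(W_n) = n if n ≥ 2k, and crx_k(W_n) = n + 1 if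
k − 1 ≤ n < 2k. -/
theorem crx_k_wheel (k n : ℕ) (hk : 4 ≤ k) (hn : k - 1 ≤ n) :
    (2 * k ≤ n → (wheelGraph n).crx k = n) ∧
      (n < 2 * k → (wheelGraph n).crx k = n + 1) := by
  have : NeZero n := ⟨by omega⟩
  have hn3 : 3 ≤ n := by omega
  obtain ⟨φ, hφ, hrain⟩ := Nat.sInf_mem (s := {r | ∃ φ : Sym2 (Option (Fin n)) → ℕ,
    (∀ e ∈ (wheelGraph n).edgeSet, φ e < r) ∧ (wheelGraph n).IsRainbowCycleColoring k φ})
    ⟨n + 1, wheelGraph.exists_coloring_succ hn3 k⟩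
  refine ⟨fun h => le_antisymm ?_ ?_, fun h => le_antisymm ?_ ?_⟩
  · exact Nat.sInf_le (wheelGraph.exists_coloring_of_two_mul_le hk h)
  · exact wheelGraph.le_of_isRainbowCycleColoring hn3 hk (by omega) hφ hrain
  · exact Nat.sInf_le (wheelGraph.exists_coloring_succ hn3 k)
  · exact wheelGraph.lt_of_isRainbowCycleColoring hn3 hk (by omega) h hφ hrain
end

section
/- For k ≥ 3, there exists N = N(k) such that for all n ≥ N, there is an edge-colouring of K_n with 2k − 1 colours under which every set of k vertices lies in a rainbow cycle; hence crx_k(K_n) ≤ 2k − 1 for n sufficiently large. -/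
open SimpleGraph

/-- A symmetric colouring of pairs of vectors `(x, y)`, the polarisation of `x ⬝ᵥ y`. -/
def polarColor {F ι : Type*} [Field F] [Fintype ι] (u v : (ι → F) × (ι → F)) : F :=
  (u.1 + v.2) ⬝ᵥ (v.1 + u.2)

theorem polarColor_comm {F ι : Type*} [Field F] [Fintype ι] (u v : (ι → F) × (ι → F)) :
    polarColor u v = polarColor v u :=
  dotProduct_comm _ _

/-- The pairs of vectors supported on two common coordinates. -/
def sparsePair {F ι : Type*} [Field F] [DecidableEq ι] (q : (ι × ι) × (F × F) × (F × F)) :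
    (ι → F) × (ι → F) :=
  (Pi.single q.1.1 q.2.1.1 + Pi.single q.1.2 q.2.2.1,
    Pi.single q.1.1 q.2.1.2 + Pi.single q.1.2 q.2.2.2)

theorem exists_polarColor_sparsePair {F ι : Type*} [Field F] [Fintype ι] [DecidableEq ι]
    [Nontrivial ι] {u v : (ι → F) × (ι → F)} (huv : u ≠ v) (a b : F) :
    ∃ q, polarColor u (sparsePair q) = a ∧ polarColor v (sparsePair q) = b := by
  obtain ⟨x, y⟩ := u
  obtain ⟨x', y'⟩ := v
  have key : ∀ (A A' B C B' C' : F), A ≠ A' → ∀ a b : F, ∃ c s t : F,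
      c * A + s * B + t * C + s * t = a ∧ c * A' + s * B' + t * C' + s * t = b := by
    intro A A' B C B' C' hA a b
    have hd : A - A' ≠ 0 := sub_ne_zero.2 hA
    -- Eliminating `c` leaves `(s + β) * (t + α) = const`.
    set r := A / (A - A') with hr
    have hrA : r * (A - A') = A := div_mul_cancel₀ _ hd
    set α := B - r * (B - B')
    set β := C - r * (C - C')
    set s := 1 - β with hs
    set t := a - r * (a - b) - s * α with ht
    refine ⟨((a - b) - s * (B - B') - t * (C - C')) / (A - A'), s, t, ?_, ?_⟩
    · have h1 : ((a - b) - s * (B - B') - t * (C - C')) / (A - A') * A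
          = ((a - b) - s * (B - B') - t * (C - C')) * r := by rw [hr]; ring
      rw [h1]
      grind
    · have h1 : ((a - b) - s * (B - B') - t * (C - C')) / (A - A') * A'
          = ((a - b) - s * (B - B') - t * (C - C')) * (r - 1) := by
        rw [hr]; field_simp; ring
      rw [h1]
      grind
  have hne : x ≠ x' ∨ y ≠ y' := by
    by_contra! h
    exact huv (Prod.ext h.1 h.2)
  rcases hne with h | h <;> obtain ⟨i, hi⟩ := Function.ne_iff.1 h <;>
    obtain ⟨j, hj⟩ := exists_ne i
  · obtain ⟨c, s, t, h1, h2⟩ := key (x i) (x' i) (x j) (y j) (x' j) (y' j) hi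
      (a - x ⬝ᵥ y) (b - x' ⬝ᵥ y')
    refine ⟨((i, j), (c, 0), (s, t)), ?_, ?_⟩
    · simp [polarColor, sparsePair, hj.symm, add_dotProduct, dotProduct_add]
      linear_combination h1
    · simp [polarColor, sparsePair, hj.symm, add_dotProduct, dotProduct_add]
      linear_combination h2
  · obtain ⟨c, s, t, h1, h2⟩ := key (y i) (y' i) (x j) (y j) (x' j) (y' j) hi
      (a - x ⬝ᵥ y) (b - x' ⬝ᵥ y')
    refine ⟨((i, j), (0, c), (s, t)), ?_, ?_⟩
    · simp [polarColor, sparsePair, hj, add_dotProduct, dotProduct_add]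
      linear_combination h1
    · simp [polarColor, sparsePair, hj, add_dotProduct, dotProduct_add]
      linear_combination h2

theorem exists_sq_mul_pow_le_and_le_pow {p n : ℕ} (hp : 2 ≤ p) (hn : 25 * p ^ 4 ≤ n) :
    ∃ m, 2 ≤ m ∧ m ^ 2 * p ^ 4 ≤ n ∧ n ≤ p ^ (m + m) := by
  have hp4 : 0 < p ^ 4 := by positivity
  have h25 : 25 ≤ n / p ^ 4 := (Nat.le_div_iff_mul_le hp4).2 hn
  have hm : 5 ≤ Nat.sqrt (n / p ^ 4) := Nat.le_sqrt.2 h25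
  set m := Nat.sqrt (n / p ^ 4) with hmdef
  have hle : m ^ 2 ≤ n / p ^ 4 := Nat.sqrt_le' _
  have hlt : n / p ^ 4 < (m + 1) ^ 2 := Nat.lt_succ_sqrt' _
  refine ⟨m, by omega, (Nat.le_div_iff_mul_le hp4).1 hle, ?_⟩
  obtain ⟨l, hl⟩ := Nat.exists_eq_add_of_le' hm
  have hpow : ∀ l : ℕ, l + 6 ≤ 2 ^ (l + 3) := by
    intro l
    induction l with
    | zero => norm_num
    | succ l ih => rw [show l + 1 + 3 = l + 3 + 1 by ring, pow_succ]; omega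
  calc n ≤ (m + 1) ^ 2 * p ^ 4 := ((Nat.div_lt_iff_lt_mul hp4).1 hlt).le
    _ ≤ (p ^ (l + 3)) ^ 2 * p ^ 4 := by
      gcongr
      rw [hl]
      exact (hpow l).trans (Nat.pow_le_pow_left hp _)
    _ = p ^ (m + m) := by rw [hl]; ring

/-- On all large enough `n`, some `r`-colouring is so rich that any two vertices see all pairs of
colours at common neighbours, even after deleting any `M` vertices. -/
theorem exists_rich_coloring (r M : ℕ) (hr : 0 < r) :
    ∃ N : ℕ, ∀ n : ℕ, N ≤ n → ∃ φ : Sym2 (Fin n) → ℕ, (∀ e, φ e < r) ∧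
      ∀ u v, u ≠ v → ∀ a < r, ∀ b < r, ∀ X : Finset (Fin n), X.card ≤ M →
        ∃ w ∉ X, φ s(u, w) = a ∧ φ s(w, v) = b := by
  classical
  obtain ⟨p, hpge, hp⟩ := Nat.exists_infinite_primes (r * (M + 1))
  have : Fact p.Prime := ⟨hp⟩
  refine ⟨25 * p ^ 4, fun n hn => ?_⟩
  obtain ⟨m, hm2, hmn, hnm⟩ := exists_sq_mul_pow_le_and_le_pow hp.two_le hn
  have : Nontrivial (Fin m) := Fin.nontrivial_iff_two_le.2 hm2
  obtain ⟨V, hWV, hV⟩ : ∃ V : Finset ((Fin m → ZMod p) × (Fin m → ZMod p)),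
      Finset.univ.image sparsePair ⊆ V ∧ V.card = n := by
    refine Finset.exists_superset_card_eq (Finset.card_image_le.trans ?_) ?_
    · refine le_trans (le_of_eq ?_) hmn
      simp [ZMod.card]
      ring
    · simpa [ZMod.card, ← pow_add] using hnm
  let e : Fin n ≃ V := (Finset.equivFinOfCardEq hV).symm
  let f : Fin n → (Fin m → ZMod p) × (Fin m → ZMod p) := fun x => e x
  have hf : Function.Injective f := Subtype.val_injective.comp e.injective
  refine ⟨Sym2.lift ⟨fun x y => (polarColor (f x) (f y)).val % r,
    fun x y => by simp only [polarColor_comm (f x)]⟩, fun e => ?_, fun u v huv a ha b hb X hX => ?_⟩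
  · induction e with
    | _ x y => exact Nat.mod_lt _ hr
  · have hw : ∀ l : ℕ, ∃ w, polarColor (f u) (f w) = ((a + r * l : ℕ) : ZMod p) ∧
        polarColor (f v) (f w) = (b : ZMod p) := by
      intro l
      obtain ⟨q, h1, h2⟩ := exists_polarColor_sparsePair (hf.ne huv) ((a + r * l : ℕ) : ZMod p) b
      have hq : f (e.symm ⟨sparsePair q, hWV (by simp)⟩) = sparsePair q := by simp [f]
      exact ⟨_, by rw [hq, h1], by rw [hq, h2]⟩
    choose w hw1 hw2 using hw
    have hlt : ∀ l ≤ M, a + r * l < p := fun l hl => by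
      have : r * l ≤ r * M := Nat.mul_le_mul_left r hl
      rw [Nat.mul_add] at hpge
      omega
    have hval : ∀ l ≤ M, (polarColor (f u) (f (w l))).val = a + r * l := fun l hl => by
      rw [hw1, ZMod.val_cast_of_lt (hlt l hl)]
    have hinj : Set.InjOn w (Finset.range (M + 1)) := by
      intro l hl l' hl' h
      simp only [Finset.coe_range, Set.mem_Iio] at hl hl'
      have h1 := hval l (by omega)
      rw [h, hval l' (by omega)] at h1
      exact (Nat.eq_of_mul_eq_mul_left hr (by omega)).symm
    obtain ⟨x, hx, hxX⟩ := Finset.exists_mem_notMem_of_card_lt_card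
      (s := X) (t := (Finset.range (M + 1)).image w)
      (by rw [Finset.card_image_of_injOn hinj, Finset.card_range]; omega)
    obtain ⟨l, hl, rfl⟩ := Finset.mem_image.1 hx
    rw [Finset.mem_range] at hl
    refine ⟨w l, hxX, ?_, ?_⟩
    · simp [hval l (by omega), Nat.mod_eq_of_lt ha]
    · have hbp : b < p := by
        have := hlt 0 (Nat.zero_le _)
        rw [Nat.mul_add] at hpge
        omega
      rw [Sym2.lift_mk]
      simp only
      rw [polarColor_comm, hw2, ZMod.val_cast_of_lt hbp, Nat.mod_eq_of_lt hb]

/-- In a rich colouring there is a path through prescribed vertices, in order, with prescribed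
edge colours, using one extra vertex between consecutive prescribed ones. -/
theorem exists_path_with_colors {V : Type*} [DecidableEq V] {φ : Sym2 V → ℕ} {r M : ℕ}
    (hφ : ∀ u v, u ≠ v → ∀ a < r, ∀ b < r, ∀ X : Finset V, X.card ≤ M →
      ∃ w ∉ X, φ s(u, w) = a ∧ φ s(w, v) = b) (l : List V) :
    ∀ (v : V) (X : Finset V) (cs : List ℕ), (v :: l).Nodup → (∀ x ∈ v :: l, x ∉ X) →
      X.card + 2 * l.length + 1 ≤ M → cs.length = 2 * l.length → (∀ c ∈ cs, c < r) →
      ∃ p : (completeGraph V).Walk v (l.getLastD v), p.IsPath ∧ (∀ x ∈ v :: l, x ∈ p.support) ∧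
        (∀ x ∈ p.support, x ∉ X) ∧ p.edges.map φ = cs := by
  induction l with
  | nil =>
    intro v X cs _ hX _ hcs _
    obtain rfl : cs = [] := List.length_eq_zero_iff.1 (by simpa using hcs)
    rw [List.getLastD_nil]
    exact ⟨Walk.nil, by simp, by simp, by simpa using hX, by simp⟩
  | cons v' l ih =>
    intro v X cs hnd hX hM hcs hlt
    match cs, hcs with
    | a :: b :: cs, hcs =>
    simp only [List.length_cons] at hM hcs
    obtain ⟨hv, hnd'⟩ := List.nodup_cons.1 hnd
    have hvv' : v ≠ v' := fun h => hv (by simp [h])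
    obtain ⟨w, hw, hwa, hwb⟩ := hφ v v' hvv' a (hlt a (by simp)) b (hlt b (by simp))
      (X ∪ (v :: v' :: l).toFinset) (by
        refine (Finset.card_union_le _ _).trans ?_
        have := List.toFinset_card_le (v :: v' :: l)
        simp only [List.length_cons] at this
        omega)
    simp only [Finset.mem_union, List.mem_toFinset, not_or] at hw
    obtain ⟨hwX, hwl⟩ := hw
    have hwv : v ≠ w := fun h => hwl (by simp [h])
    have hwv' : w ≠ v' := fun h => hwl (by simp [h])
    obtain ⟨p, hp, hpl, hpX, hpc⟩ := ih v' (insert v (insert w X)) cs hnd'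
      (by
        intro x hx
        simp only [Finset.mem_insert, not_or]
        exact ⟨fun h => hv (h ▸ hx), fun h => hwl (by rw [← h]; exact List.mem_cons_of_mem _ hx),
          hX x (List.mem_cons_of_mem _ hx)⟩)
      (by
        have h1 := Finset.card_insert_le v (insert w X)
        have h2 := Finset.card_insert_le w X
        omega)
      (by omega) (fun c hc => hlt c (by simp [hc]))
    have h1 : (completeGraph V).Adj v w := hwv
    have h2 : (completeGraph V).Adj w v' := hwv'
    have hvp : v ∉ p.support := fun h => hpX v h (by simp)
    have hwp : w ∉ p.support := fun h => hpX w h (by simp)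
    rw [List.getLastD_cons]
    refine ⟨Walk.cons h1 (Walk.cons h2 p), ?_, ?_, ?_, ?_⟩
    · simp [Walk.cons_isPath_iff, hp, hvp, hwp, hwv]
    · intro x hx
      rcases List.mem_cons.1 hx with rfl | hx
      · simp
      · simp [hpl x hx]
    · intro x hx
      simp only [Walk.support_cons, List.mem_cons] at hx
      rcases hx with rfl | rfl | hx
      · exact hX _ (by simp)
      · exact hwX
      · exact fun h => hpX x hx (by simp [h])
    · simp [hwa, hwb, hpc]

/-- for k ≥ 3 there exists N such that crx_k(K_n) ≤ 2k − 1 for all n ≥ N. -/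
theorem crx_k_complete_upper (k : ℕ) (hk : 3 ≤ k) :
    ∃ N : ℕ, ∀ n : ℕ, N ≤ n → (completeGraph (Fin n)).crx k ≤ 2 * k - 1 := by
  obtain ⟨N, hN⟩ := exists_rich_coloring (2 * k - 1) (2 * k) (by omega)
  refine ⟨N, fun n hn => ?_⟩
  obtain ⟨φ, hφr, hφ⟩ := hN n hn
  refine Nat.sInf_le ⟨φ, fun e _ => hφr e, fun S hS => ?_⟩
  have hlen : S.toList.length = k := by simpa using hS
  have hnd : S.toList.Nodup := S.nodup_toList
  have hmem : ∀ v ∈ S, v ∈ S.toList := fun v hv => by simpa using hv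
  generalize S.toList = L at hlen hnd hmem
  obtain ⟨v, L, rfl⟩ := List.exists_cons_of_length_pos (l := L) (by omega)
  rw [List.length_cons] at hlen
  obtain ⟨v', l, rfl⟩ := List.exists_cons_of_length_pos (l := L) (by omega)
  rw [List.length_cons] at hlen
  set z := (v' :: l).getLastD v with hz
  have hzv : z ≠ v := by
    intro h
    have : z ∈ v' :: l := by
      rw [hz, List.getLastD_cons, ← List.getLast_eq_getLastD (List.cons_ne_nil v' l)]
      exact List.getLast_mem _
    exact (List.nodup_cons.1 hnd).1 (h ▸ this)
  have hzr : φ s(z, v) < 2 * k - 1 := hφr _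
  have hrange : (List.range (2 * k - 1)).Nodup := List.nodup_range
  obtain ⟨p, hp, hpl, -, hpc⟩ := exists_path_with_colors hφ (v' :: l) v ∅
    ((List.range (2 * k - 1)).erase (φ s(z, v))) hnd (by simp)
    (by simp only [Finset.card_empty, List.length_cons]; omega)
    (by rw [List.length_erase_of_mem (List.mem_range.2 hzr)]; simp; omega)
    (fun c hc => List.mem_range.1 (List.mem_of_mem_erase hc))
  have hnot : φ s(z, v) ∉ p.edges.map φ := by
    rw [hpc]
    exact hrange.not_mem_erase
  have hadj : (completeGraph (Fin n)).Adj z v := hzv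
  refine ⟨z, Walk.cons hadj p, ?_, ?_, ?_⟩
  · exact (Walk.cons_isCycle_iff _ _).2 ⟨hp, fun h => hnot (List.mem_map_of_mem h)⟩
  · intro x hx
    simp [hpl x (hmem x hx)]
  · rw [Walk.edges_cons, List.map_cons, List.nodup_cons]
    exact ⟨hnot, hpc ▸ hrange.erase _⟩
end
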